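/- Let R be a standard bigraded K-algebra with irrelevant bigraded ideals P and Q, where P is minimally generated by m homogeneous elements, and let M be a finitely generated bigraded R-module of dimension s and depth t. Then the R-modules H^{t-m}_Q(M) and H^s_Q(M) are tame. -/

import Mathlib

/-!
Common framework: standard bigraded algebras, bigraded modules, bigraded Matlis duals
(characterized by a perfect pairing), and `ℤ`-indexed local cohomology.
-/

open CategoryTheory

universe u

noncomputable section

/-- `ℤ`-indexed local cohomology: `H^k_I(M)` for `k : ℤ`, zero for negative `k`. -/
noncomputable def LC (R : Type u) [CommRing R] (I : Ideal R) (k : ℤ)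
    (M : Type u) [AddCommGroup M] [Module R M] : ModuleCat.{u} R :=
  if 0 ≤ k then (localCohomology I k.toNat).obj (ModuleCat.of R M)
  else ModuleCat.of R PUnit

variable (K R : Type u) [Field K] [CommRing R] [Algebra K R] (𝒜 : ℕ × ℕ → Submodule K R)

/-- The irrelevant bigraded ideal `P` generated by all elements of degree `(1,0)`. -/
def idealP : Ideal R := Ideal.span (𝒜 (1, 0) : Set R)

/-- The irrelevant bigraded ideal `Q` generated by all elements of degree `(0,1)`. -/
def idealQ : Ideal R := Ideal.span (𝒜 (0, 1) : Set R)

/-- The unique graded maximal ideal `R₊ = P + Q`. -/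
def idealRPlus : Ideal R := idealP K R 𝒜 ⊔ idealQ K R 𝒜

/-- `R` is a standard bigraded `K`-algebra: `R_{(0,0)} = K` and `R` is generated over `K`
by the (finite-dimensional) components of degrees `(1,0)` and `(0,1)`. -/
structure IsStandardBigraded [GradedAlgebra 𝒜] : Prop where
  degree_zero : 𝒜 (0, 0) = Subalgebra.toSubmodule (⊥ : Subalgebra K R)
  fg10 : (𝒜 (1, 0)).FG
  fg01 : (𝒜 (0, 1)).FG
  adjoin_eq_top : Algebra.adjoin K ((𝒜 (1, 0) : Set R) ∪ (𝒜 (0, 1) : Set R)) = ⊤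

/-- A bigraded `R`-module structure on `M`: an internal direct sum decomposition into
`K`-stable additive subgroups, compatible with the bigrading `𝒜` of `R`. -/
structure Bigrading (M : Type u) [AddCommGroup M] [Module R M] : Type u where
  grading : ℤ × ℤ → AddSubgroup M
  ksmul_mem : ∀ (c : K) (b : ℤ × ℤ) (x : M), x ∈ grading b → algebraMap K R c • x ∈ grading b
  internal : DirectSum.IsInternal grading
  compat : ∀ (a : ℕ × ℕ) (b : ℤ × ℤ) (r : R) (x : M), r ∈ 𝒜 a → x ∈ grading b →
    r • x ∈ grading (((a.1 : ℤ), (a.2 : ℤ)) + b)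

/-- Data exhibiting a bigraded Matlis dual of `M`: a bigrading `src` on `M`, a bigraded
`R`-module `D`, and an `R`-balanced `K`-bilinear pairing `D × M → K` which puts the component
of `D` of degree `a` in perfect duality with the component of `M` of degree `-a`
(and is zero between components of degrees `a`, `b` with `a + b ≠ 0`).  This characterizes
`D` as the bigraded module with `D_{(i,j)} = Hom_K (M_{(-i,-j)}, K)`. -/
structure DualData (M : Type u) [AddCommGroup M] [Module R M] : Type (u + 1) where
  src : Bigrading K R 𝒜 M
  D : Type u
  [addCommGroup : AddCommGroup D]
  [module : Module R D]
  bg : Bigrading K R 𝒜 D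
  pairing : D →+ M →+ K
  pairing_smul : ∀ (r : R) (d : D) (x : M), pairing (r • d) x = pairing d (r • x)
  pairing_ksmul : ∀ (c : K) (d : D) (x : M), pairing (algebraMap K R c • d) x = c * pairing d x
  orth : ∀ (a b : ℤ × ℤ), a + b ≠ 0 → ∀ d ∈ bg.grading a, ∀ x ∈ src.grading b, pairing d x = 0
  nondeg : ∀ (a : ℤ × ℤ) (d : D), d ∈ bg.grading a →
    (∀ x ∈ src.grading (-a), pairing d x = 0) → d = 0
  full : ∀ (a : ℤ × ℤ) (φ : M →+ K),
    (∀ (c : K) (x : M), φ (algebraMap K R c • x) = c * φ x) →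
    ∃ d ∈ bg.grading a, ∀ x ∈ src.grading (-a), pairing d x = φ x

attribute [instance] DualData.addCommGroup DualData.module

/-- A bigraded module is tame if, viewing it as graded by the second degree `j`
(with components `N_j = ⊕_i N_{(i,j)}`), there is `j₀` such that either all components with
`j ≤ j₀` vanish, or all components with `j ≤ j₀` are nonzero. -/
def IsTame {M : Type u} [AddCommGroup M] [Module R M] (bg : Bigrading K R 𝒜 M) : Prop :=
  ∃ j₀ : ℤ, (∀ j ≤ j₀, ∀ i : ℤ, bg.grading (i, j) = ⊥) ∨ (∀ j ≤ j₀, ∃ i : ℤ, bg.grading (i, j) ≠ ⊥)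

/-- The ideal `P` is minimally generated by `m` (homogeneous, of degree `(1,0)`) elements. -/
def MinimallyGeneratedBy (m : ℕ) : Prop :=
  (∃ s : Finset R, (↑s : Set R) ⊆ (𝒜 (1, 0) : Set R) ∧ Ideal.span (↑s : Set R) = idealP K R 𝒜 ∧
      s.card = m) ∧
  ∀ s : Finset R, Ideal.span (↑s : Set R) = idealP K R 𝒜 → m ≤ s.card

/-! ### Localization of a module at the powers of one element -/

section Away

variable {A : Type u} [CommRing A] (f : A)
variable (M : Type u) [AddCommGroup M] [Module A M]
variable {N P : Type u} [AddCommGroup N] [Module A N] [AddCommGroup P] [Module A P]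

/-- The localization of `M` at the powers of `f`. -/
abbrev ModAway : Type u := LocalizedModule (Submonoid.powers f) M

/-- The localization map `M → M_f`. -/
def toAway : M →ₗ[A] ModAway f M := LocalizedModule.mkLinearMap (Submonoid.powers f) M

instance : IsLocalizedModule (Submonoid.powers f) (toAway f M) :=
  inferInstanceAs (IsLocalizedModule _ (LocalizedModule.mkLinearMap (Submonoid.powers f) M))

variable {M}

/-- The map induced on localizations at the powers of `f`. -/
def awayMap (h : M →ₗ[A] N) : ModAway f M →ₗ[A] ModAway f N :=
  IsLocalizedModule.map (Submonoid.powers f) (toAway f M) (toAway f N) h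

@[simp]
theorem awayMap_toAway (h : M →ₗ[A] N) (x : M) :
    awayMap f h (toAway f M x) = toAway f N (h x) :=
  IsLocalizedModule.map_apply _ _ _ _ _

theorem exists_pow_smul_eq_toAway (z : ModAway f M) :
    ∃ (n : ℕ) (x : M), f ^ n • z = toAway f M x := by
  obtain ⟨⟨x, ⟨_, n, rfl⟩⟩, h⟩ := IsLocalizedModule.surj (Submonoid.powers f) (toAway f M) z
  exact ⟨n, x, h⟩

theorem toAway_eq_zero_iff {x : M} : toAway f M x = 0 ↔ ∃ n : ℕ, f ^ n • x = 0 := by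
  rw [IsLocalizedModule.eq_zero_iff (Submonoid.powers f)]
  constructor
  · rintro ⟨⟨_, n, rfl⟩, h⟩
    exact ⟨n, h⟩
  · rintro ⟨n, h⟩
    exact ⟨⟨_, n, rfl⟩, h⟩

theorem pow_smul_away_injective (n : ℕ) {z w : ModAway f M} (h : f ^ n • z = f ^ n • w) : z = w :=
  IsLocalizedModule.smul_injective (toAway f M) (⟨_, n, rfl⟩ : Submonoid.powers f) h

theorem eq_zero_of_pow_smul_away (n : ℕ) {z : ModAway f M} (h : f ^ n • z = 0) : z = 0 :=
  pow_smul_away_injective f n (by simpa using h)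

theorem exists_pow_smul_away (n : ℕ) (z : ModAway f M) : ∃ w : ModAway f M, f ^ n • w = z := by
  obtain ⟨⟨x, s⟩, rfl⟩ :=
    IsLocalizedModule.mk'_surjective (Submonoid.powers f) (toAway f M) z
  refine ⟨IsLocalizedModule.mk' (toAway f M) x (s * ⟨_, n, rfl⟩), ?_⟩
  have := IsLocalizedModule.mk'_cancel_right (toAway f M) x s ⟨f ^ n, n, rfl⟩
  rw [Function.uncurry_apply_pair, ← this]
  exact (IsLocalizedModule.mk'_smul _ _ _ _).symm

theorem awayMap_injective {h : M →ₗ[A] N} (hh : Function.Injective h) :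
    Function.Injective (awayMap f h) :=
  IsLocalizedModule.map_injective _ _ _ _ hh

theorem awayMap_surjective {h : M →ₗ[A] N} (hh : Function.Surjective h) :
    Function.Surjective (awayMap f h) :=
  IsLocalizedModule.map_surjective _ _ _ _ hh

theorem awayMap_exact {h : M →ₗ[A] N} {g : N →ₗ[A] P} (e : Function.Exact h g) :
    Function.Exact (awayMap f h) (awayMap f g) :=
  IsLocalizedModule.map_exact _ _ _ _ _ _ e

theorem awayMap_comp (h : M →ₗ[A] N) (g : N →ₗ[A] P) (z : ModAway f M) :
    awayMap f g (awayMap f h z) = awayMap f (g ∘ₗ h) z := by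
  obtain ⟨n, x, hx⟩ := exists_pow_smul_eq_toAway f z
  apply pow_smul_away_injective f n
  rw [← map_smul, ← map_smul, ← map_smul, hx]
  simp only [awayMap_toAway, LinearMap.comp_apply]

theorem awayMap_zero (z : ModAway f M) : awayMap f (0 : M →ₗ[A] N) z = 0 := by
  simp [awayMap]

theorem awayMap_add (h g : M →ₗ[A] N) : awayMap f (h + g) = awayMap f h + awayMap f g := by
  simp [awayMap]

theorem awayMap_smul (r : A) (h : M →ₗ[A] N) : awayMap f (r • h) = r • awayMap f h := by
  simp [awayMap]

/-- Every element of `M` is killed by a power of `f`. -/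
def IsPowTorsion (M : Type u) [AddCommGroup M] [Module A M] : Prop :=
  ∀ x : M, ∃ n : ℕ, f ^ n • x = 0

theorem IsPowTorsion.subsingleton (h : IsPowTorsion f M) : Subsingleton (ModAway f M) := by
  refine subsingleton_of_forall_eq 0 fun z => ?_
  obtain ⟨n, x, hx⟩ := exists_pow_smul_eq_toAway f z
  exact eq_zero_of_pow_smul_away f n (hx.trans ((toAway_eq_zero_iff f).2 (h x)))

theorem IsPowTorsion.away {g : A} (h : IsPowTorsion f M) : IsPowTorsion f (ModAway g M) := by
  intro z
  obtain ⟨n, x, hx⟩ := exists_pow_smul_eq_toAway g z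
  obtain ⟨m, hm⟩ := h x
  refine ⟨m, eq_zero_of_pow_smul_away g n ?_⟩
  rw [smul_comm, hx, ← map_smul, hm, map_zero]

theorem IsPowTorsion.prod (h : IsPowTorsion f M) (h' : IsPowTorsion f N) :
    IsPowTorsion f (M × N) := by
  rintro ⟨x, y⟩
  obtain ⟨m, hm⟩ := h x
  obtain ⟨n, hn⟩ := h' y
  refine ⟨m + n, Prod.ext ?_ ?_⟩
  · simp [pow_add, mul_smul, hm, smul_comm (f ^ m)]
  · simp [pow_add, mul_smul, hn]

theorem IsPowTorsion.of_subsingleton [Subsingleton M] : IsPowTorsion f M :=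
  fun _ => ⟨0, Subsingleton.elim _ _⟩

end Away

/-! ### Cochain complexes of modules -/

/-- A cochain complex of `A`-modules in nonnegative degrees. -/
structure ModComplex (A : Type u) [CommRing A] where
  X : ℕ → Type u
  [addCommGroup : ∀ k, AddCommGroup (X k)]
  [module : ∀ k, Module A (X k)]
  d : ∀ k, X k →ₗ[A] X (k + 1)
  d_d : ∀ k x, d (k + 1) (d k x) = 0

attribute [instance] ModComplex.addCommGroup ModComplex.module

namespace ModComplex

variable {A : Type u} [CommRing A]

/-- The term of degree `k - 1` of a complex. -/
def prev (C : ModComplex A) : ℕ → Type u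
  | 0 => PUnit
  | k + 1 => C.X k

instance (C : ModComplex A) (k : ℕ) : AddCommGroup (C.prev k) :=
  match k with
  | 0 => (inferInstance : AddCommGroup PUnit.{u + 1})
  | k + 1 => C.addCommGroup k

instance (C : ModComplex A) (k : ℕ) : Module A (C.prev k) :=
  match k with
  | 0 => (PUnit.module : Module A PUnit.{u + 1})
  | k + 1 => C.module k

/-- The differential from degree `k - 1` to degree `k`. -/
def dPrev (C : ModComplex A) : ∀ k, C.prev k →ₗ[A] C.X k
  | 0 => 0
  | k + 1 => C.d k

theorem d_dPrev (C : ModComplex A) : ∀ k x, C.d k (C.dPrev k x) = 0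
  | 0, _ => map_zero _
  | k + 1, x => C.d_d k x

/-- The cocycles. -/
abbrev cocycles (C : ModComplex A) (k : ℕ) : Submodule A (C.X k) := LinearMap.ker (C.d k)

/-- The coboundaries. -/
abbrev coboundaries (C : ModComplex A) (k : ℕ) : Submodule A (C.X k) :=
  LinearMap.range (C.dPrev k)

/-- The cohomology. -/
abbrev H (C : ModComplex A) (k : ℕ) : Type u :=
  C.cocycles k ⧸ (C.coboundaries k).comap (C.cocycles k).subtype

/-- The class of a cocycle. -/
abbrev cls (C : ModComplex A) (k : ℕ) : C.cocycles k →ₗ[A] C.H k := Submodule.mkQ _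

theorem cls_surjective (C : ModComplex A) (k : ℕ) : Function.Surjective (C.cls k) :=
  Submodule.mkQ_surjective _

theorem cls_eq_zero (C : ModComplex A) {k : ℕ} {x : C.cocycles k} :
    C.cls k x = 0 ↔ (x : C.X k) ∈ C.coboundaries k :=
  Submodule.Quotient.mk_eq_zero _

/-- The cohomology in degree `k` vanishes. -/
def Acyclic (C : ModComplex A) (k : ℕ) : Prop := C.cocycles k ≤ C.coboundaries k

theorem acyclic_iff (C : ModComplex A) {k : ℕ} : C.Acyclic k ↔ ∀ z : C.H k, z = 0 := by
  constructor
  · intro h z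
    obtain ⟨x, rfl⟩ := C.cls_surjective k z
    exact C.cls_eq_zero.2 (h x.2)
  · intro h x hx
    exact C.cls_eq_zero.1 (h (C.cls k ⟨x, hx⟩))

/-- A morphism of complexes. -/
structure Hom (C D : ModComplex A) where
  f : ∀ k, C.X k →ₗ[A] D.X k
  comm : ∀ k x, f (k + 1) (C.d k x) = D.d k (f k x)

variable {C D E : ModComplex A}

/-- The component of a morphism in degree `k - 1`. -/
def Hom.fPrev (φ : Hom C D) : ∀ k, C.prev k →ₗ[A] D.prev k
  | 0 => 0
  | k + 1 => φ.f k

theorem Hom.comm_prev (φ : Hom C D) : ∀ k x, φ.f k (C.dPrev k x) = D.dPrev k (φ.fPrev k x)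
  | 0, _ => by simp [dPrev]
  | k + 1, x => φ.comm k x

theorem Hom.map_mem_cocycles (φ : Hom C D) {k : ℕ} {x : C.X k} (hx : x ∈ C.cocycles k) :
    φ.f k x ∈ D.cocycles k := by
  rw [LinearMap.mem_ker, ← φ.comm, LinearMap.mem_ker.1 hx, map_zero]

theorem Hom.map_mem_coboundaries (φ : Hom C D) {k : ℕ} {x : C.X k}
    (hx : x ∈ C.coboundaries k) : φ.f k x ∈ D.coboundaries k := by
  obtain ⟨y, rfl⟩ := hx
  exact ⟨_, (φ.comm_prev k y).symm⟩

/-- The map induced on cocycles. -/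
def Hom.mapCocycles (φ : Hom C D) (k : ℕ) : C.cocycles k →ₗ[A] D.cocycles k :=
  (φ.f k).restrict fun _ => φ.map_mem_cocycles

/-- The map induced on cohomology. -/
def Hom.mapH (φ : Hom C D) (k : ℕ) : C.H k →ₗ[A] D.H k :=
  Submodule.mapQ _ _ (φ.mapCocycles k) fun _ hx => φ.map_mem_coboundaries hx

@[simp]
theorem Hom.mapH_cls (φ : Hom C D) (k : ℕ) (x : C.cocycles k) :
    φ.mapH k (C.cls k x) = D.cls k (φ.mapCocycles k x) := rfl

@[simp]
theorem Hom.coe_mapCocycles (φ : Hom C D) (k : ℕ) (x : C.cocycles k) :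
    (φ.mapCocycles k x : D.X k) = φ.f k x := rfl

/-- A degreewise short exact sequence of complexes. -/
structure IsShortExact (φ : Hom C D) (ψ : Hom D E) : Prop where
  inj : ∀ k, Function.Injective (φ.f k)
  exact : ∀ k, Function.Exact (φ.f k) (ψ.f k)
  surj : ∀ k, Function.Surjective (ψ.f k)

namespace IsShortExact

variable {φ : Hom C D} {ψ : Hom D E} (h : IsShortExact φ ψ)
include h

theorem surj_prev : ∀ k, Function.Surjective (ψ.fPrev k)
  | 0 => fun _ => ⟨0, Subsingleton.elim (α := PUnit) _ _⟩
  | k + 1 => h.surj k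

theorem inj_prev : ∀ k, Function.Injective (φ.fPrev k)
  | 0 => fun _ _ _ => Subsingleton.elim (α := PUnit) _ _
  | k + 1 => h.inj k

theorem exact_prev : ∀ k, Function.Exact (φ.fPrev k) (ψ.fPrev k)
  | 0 => fun x => ⟨fun _ => ⟨x, Subsingleton.elim (α := PUnit) _ _⟩,
      fun _ => Subsingleton.elim (α := PUnit) _ _⟩
  | k + 1 => h.exact k

theorem exact_mapH (k : ℕ) : Function.Exact (φ.mapH k) (ψ.mapH k) := by
  intro z
  obtain ⟨x, rfl⟩ := D.cls_surjective k z
  constructor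
  · intro hz
    obtain ⟨e, he⟩ := E.cls_eq_zero.1 hz
    obtain ⟨y, rfl⟩ := h.surj_prev k e
    rw [Hom.coe_mapCocycles, ← ψ.comm_prev, eq_comm, ← sub_eq_zero, ← map_sub] at he
    obtain ⟨c, hc⟩ := (h.exact k _).1 he
    have hcc : c ∈ C.cocycles k := by
      rw [LinearMap.mem_ker]
      apply h.inj
      rw [φ.comm, hc, map_sub, D.d_dPrev, map_zero, sub_zero]
      exact x.2
    refine ⟨C.cls k ⟨c, hcc⟩, ?_⟩
    rw [Hom.mapH_cls, ← sub_eq_zero, ← map_sub, D.cls_eq_zero]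
    refine ⟨-y, ?_⟩
    simp [hc]
  · rintro ⟨w, hw⟩
    obtain ⟨c, rfl⟩ := C.cls_surjective k w
    rw [← hw]
    simp only [Hom.mapH_cls]
    rw [E.cls_eq_zero]
    have : ψ.f k (φ.f k c) = 0 := (h.exact k _).2 ⟨_, rfl⟩
    simp [this]

omit h in
/-- A linear relation with full domain whose indeterminacy vanishes is a linear map. -/
theorem _root_.LinearMap.exists_comp_eq {W U V : Type u} [AddCommGroup W] [Module A W]
    [AddCommGroup U] [Module A U] [AddCommGroup V] [Module A V]
    (p : W →ₗ[A] U) (q : W →ₗ[A] V) (hp : Function.Surjective p)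
    (hpq : LinearMap.ker p ≤ LinearMap.ker q) : ∃ δ : U →ₗ[A] V, ∀ w, δ (p w) = q w := by
  refine ⟨(LinearMap.ker p).liftQ q hpq ∘ₗ (p.quotKerEquivOfSurjective hp).symm, fun w => ?_⟩
  have : (p.quotKerEquivOfSurjective hp).symm (p w) = Submodule.Quotient.mk w := by
    rw [LinearEquiv.symm_apply_eq]; rfl
  simp [this]

/-- The connecting homomorphism. -/
theorem exists_delta (k : ℕ) : ∃ δ : E.H k →ₗ[A] C.H (k + 1),
    Function.Exact (ψ.mapH k) δ ∧ Function.Exact δ (φ.mapH (k + 1)) := by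
  let W : Submodule A (D.X k × C.X (k + 1)) :=
    LinearMap.eqLocus (D.d k ∘ₗ LinearMap.fst A _ _) (φ.f (k + 1) ∘ₗ LinearMap.snd A _ _)
  have hW : ∀ w : W, D.d k w.1.1 = φ.f (k + 1) w.1.2 := fun w => w.2
  have hp : ∀ w : W, (ψ.f k ∘ₗ LinearMap.fst A _ _ ∘ₗ W.subtype) w ∈ E.cocycles k := by
    intro w
    simp only [LinearMap.coe_comp, Function.comp_apply, LinearMap.mem_ker]
    rw [← ψ.comm]
    simp only [Submodule.coe_subtype, LinearMap.fst_apply, hW]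
    exact (h.exact _ _).2 ⟨_, rfl⟩
  have hq : ∀ w : W, (LinearMap.snd A _ _ ∘ₗ W.subtype) w ∈ C.cocycles (k + 1) := by
    intro w
    rw [LinearMap.mem_ker]
    apply h.inj
    rw [φ.comm]
    simp only [Submodule.coe_subtype, LinearMap.snd_apply, LinearMap.comp_apply, ← hW, D.d_d,
      map_zero]
  let p : W →ₗ[A] E.H k := E.cls k ∘ₗ LinearMap.codRestrict _ _ hp
  let q : W →ₗ[A] C.H (k + 1) := C.cls (k + 1) ∘ₗ LinearMap.codRestrict _ _ hq
  have hmk : ∀ (y : D.X k) (c : C.X (k + 1)), D.d k y = φ.f (k + 1) c → (y, c) ∈ W :=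
    fun y c hyc => hyc
  have hps : Function.Surjective p := by
    intro z
    obtain ⟨⟨e, he⟩, rfl⟩ := E.cls_surjective k z
    obtain ⟨y, rfl⟩ := h.surj k e
    rw [LinearMap.mem_ker, ← ψ.comm] at he
    obtain ⟨c, hc⟩ := (h.exact _ _).1 he
    exact ⟨⟨(y, c), hmk _ _ hc.symm⟩, rfl⟩
  have hpq : LinearMap.ker p ≤ LinearMap.ker q := by
    intro w hw
    obtain ⟨e, he⟩ := E.cls_eq_zero.1 (LinearMap.mem_ker.1 hw)
    obtain ⟨y, rfl⟩ := h.surj_prev k e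
    rw [← ψ.comm_prev, eq_comm] at he
    change ψ.f k w.1.1 = _ at he
    rw [← sub_eq_zero, ← map_sub] at he
    obtain ⟨c, hc⟩ := (h.exact k _).1 he
    rw [LinearMap.mem_ker]
    refine C.cls_eq_zero.2 ⟨c, h.inj _ ?_⟩
    change φ.f (k + 1) (C.d k c) = φ.f (k + 1) w.1.2
    rw [φ.comm, hc, ← hW, map_sub, D.d_dPrev, sub_zero]
  obtain ⟨δ, hδ⟩ := LinearMap.exists_comp_eq p q hps hpq
  refine ⟨δ, fun z => ⟨fun hz => ?_, ?_⟩, fun z => ⟨fun hz => ?_, ?_⟩⟩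
  · obtain ⟨w, rfl⟩ := hps z
    rw [hδ] at hz
    obtain ⟨(c : C.X k), hc⟩ := C.cls_eq_zero.1 hz
    change C.d k c = w.1.2 at hc
    have hcy : w.1.1 - φ.f k c ∈ D.cocycles k := by
      rw [LinearMap.mem_ker, map_sub, hW, ← φ.comm, hc, sub_self]
    refine ⟨D.cls k ⟨_, hcy⟩, ?_⟩
    rw [Hom.mapH_cls]
    change _ = E.cls k _
    congr 1
    ext
    change ψ.f k (w.1.1 - φ.f k c) = ψ.f k w.1.1
    rw [map_sub, (h.exact k (φ.f k c)).2 ⟨_, rfl⟩, sub_zero]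
  · rintro ⟨x, rfl⟩
    obtain ⟨x, rfl⟩ := D.cls_surjective k x
    have : ψ.mapH k (D.cls k x) = p ⟨(x.1, 0), hmk _ _ (by simp)⟩ := rfl
    rw [this, hδ]
    exact C.cls_eq_zero.2 (Submodule.zero_mem _)
  · obtain ⟨c, rfl⟩ := C.cls_surjective _ z
    obtain ⟨y, hy⟩ := D.cls_eq_zero.1 hz
    exact ⟨p ⟨(y, c), hmk _ _ hy⟩, hδ _⟩
  · rintro ⟨x, rfl⟩
    obtain ⟨w, rfl⟩ := hps x
    rw [hδ]
    exact D.cls_eq_zero.2 ⟨w.1.1, hW w⟩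

theorem acyclic_mid {k : ℕ} (h₁ : C.Acyclic k) (h₂ : E.Acyclic k) : D.Acyclic k := by
  rw [acyclic_iff] at *
  intro z
  obtain ⟨w, rfl⟩ := (h.exact_mapH k z).1 (h₂ _)
  rw [h₁ w, map_zero]

theorem acyclic_right {k : ℕ} (h₁ : D.Acyclic k) (h₂ : C.Acyclic (k + 1)) : E.Acyclic k := by
  rw [acyclic_iff] at *
  obtain ⟨δ, h₃, -⟩ := h.exists_delta k
  intro z
  obtain ⟨w, rfl⟩ := (h₃ z).1 (h₂ _)
  rw [h₁ w, map_zero]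

theorem mapH_surjective {k : ℕ} (h₁ : C.Acyclic (k + 1)) : Function.Surjective (ψ.mapH k) := by
  rw [acyclic_iff] at h₁
  obtain ⟨δ, h₃, -⟩ := h.exists_delta k
  exact fun z => (h₃ z).1 (h₁ _)

end IsShortExact

end ModComplex

/-! ### The fiber of the localization map of a complex, and Čech complexes -/

namespace ModComplex

variable {A : Type u} [CommRing A]

/-- The shifted cone of the localization map `C → C_f`. -/
def Fib (C : ModComplex A) (f : A) : ModComplex A where
  X k := C.X k × ModAway f (C.prev k)
  d k := (C.d k ∘ₗ LinearMap.fst A _ _).prod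
    ((toAway f (C.X k) ∘ₗ LinearMap.fst A (C.X k) (ModAway f (C.prev k)) -
      awayMap f (C.dPrev k) ∘ₗ LinearMap.snd A (C.X k) (ModAway f (C.prev k)) :
        C.X k × ModAway f (C.prev k) →ₗ[A] ModAway f (C.X k)))
  d_d k x := by
    refine Prod.ext (C.d_d k x.1) ?_
    change toAway f _ (C.d k x.1) -
      awayMap f (C.d k) (toAway f _ x.1 - awayMap f (C.dPrev k) x.2) = 0
    have : C.d k ∘ₗ C.dPrev k = 0 := LinearMap.ext (C.d_dPrev k)
    rw [map_sub, awayMap_toAway, awayMap_comp, this, awayMap_zero, sub_zero, sub_self]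

variable (C : ModComplex A) (f : A) {k : ℕ}

/-- The element of the fiber with given components. -/
def fibMk (a : C.X k) (b : ModAway f (C.prev k)) : (C.Fib f).X k := (a, b)

theorem exists_fibMk (z : (C.Fib f).X k) : ∃ a b, C.fibMk f a b = z := ⟨z.1, z.2, rfl⟩

theorem fibMk_add (a a' : C.X k) (b b' : ModAway f (C.prev k)) :
    C.fibMk f a b + C.fibMk f a' b' = C.fibMk f (a + a') (b + b') := rfl

theorem smul_fibMk (r : A) (a : C.X k) (b : ModAway f (C.prev k)) :
    r • C.fibMk f a b = C.fibMk f (r • a) (r • b) := rfl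

theorem fibMk_inj {a a' : C.X k} {b b' : ModAway f (C.prev k)} :
    C.fibMk f a b = C.fibMk f a' b' ↔ a = a' ∧ b = b' := Prod.ext_iff

theorem fibMk_zero : C.fibMk f (0 : C.X k) 0 = 0 := rfl

theorem Fib_d (a : C.X k) (b : ModAway f (C.prev k)) :
    (C.Fib f).d k (C.fibMk f a b) =
      C.fibMk f (k := k + 1) (C.d k a) (toAway f (C.X k) a - awayMap f (C.dPrev k) b) := rfl

theorem mem_cocycles_Fib {a : C.X k} {b : ModAway f (C.prev k)} :
    C.fibMk f a b ∈ (C.Fib f).cocycles k ↔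
      a ∈ C.cocycles k ∧ toAway f (C.X k) a = awayMap f (C.dPrev k) b := by
  rw [LinearMap.mem_ker, LinearMap.mem_ker, Fib_d, ← sub_eq_zero (a := toAway f (C.X k) a)]
  exact Prod.ext_iff

instance : Subsingleton (C.prev 0) := inferInstanceAs (Subsingleton PUnit)

instance : Subsingleton (ModAway f (C.prev 0)) :=
  IsPowTorsion.subsingleton f (IsPowTorsion.of_subsingleton f)

theorem mk_mem_coboundaries_Fib (y : C.prev k) :
    C.fibMk f (C.dPrev k y) (toAway f (C.prev k) y) ∈ (C.Fib f).coboundaries k := by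
  cases k with
  | zero =>
    refine ⟨0, ?_⟩
    rw [map_zero]
    exact Prod.ext rfl (Subsingleton.elim _ _)
  | succ k =>
    refine ⟨C.fibMk f (k := k) y 0, ?_⟩
    refine Prod.ext rfl ?_
    change toAway f (C.X k) y - awayMap f (C.dPrev k) 0 = toAway f (C.X k) y
    rw [map_zero, sub_zero]

theorem zero_mk_mem_coboundaries_Fib (b : ModAway f (C.prev k)) :
    C.fibMk f (k := k + 1) 0 (awayMap f (C.dPrev k) b) ∈
      (C.Fib f).coboundaries (k + 1) := by
  refine ⟨C.fibMk f 0 (-b), ?_⟩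
  change C.fibMk f (k := k + 1) (C.d k 0) (toAway f (C.X k) 0 - awayMap f (C.dPrev k) (-b)) = _
  rw [map_zero, map_zero, map_neg, zero_sub, neg_neg]

theorem exists_of_mem_coboundaries_Fib {a : C.X k} {b : ModAway f (C.prev k)}
    (h : C.fibMk f a b ∈ (C.Fib f).coboundaries k) : a ∈ C.coboundaries k := by
  cases k with
  | zero =>
    obtain ⟨y, hy⟩ := h
    exact ⟨0, congrArg Prod.fst hy⟩
  | succ k =>
    obtain ⟨y, hy⟩ := h
    exact ⟨y.1, congrArg Prod.fst hy⟩

theorem exists_of_mem_coboundaries_Fib_succ {a : C.X (k + 1)} {b : ModAway f (C.X k)}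
    (h : C.fibMk f (k := k + 1) a b ∈ (C.Fib f).coboundaries (k + 1)) :
    ∃ (y : C.X k) (w : ModAway f (C.prev k)),
      C.d k y = a ∧ toAway f (C.X k) y - awayMap f (C.dPrev k) w = b := by
  obtain ⟨y, hy⟩ := h
  exact ⟨y.1, y.2, congrArg Prod.fst hy, congrArg Prod.snd hy⟩

/-- A cocycle of a localized complex is, up to a power of `f`, represented by a cocycle. -/
theorem exists_cocycle_of_away {b : ModAway f (C.X k)} (hb : awayMap f (C.d k) b = 0) :
    ∃ (n : ℕ) (c : C.X k), c ∈ C.cocycles k ∧ f ^ n • b = toAway f (C.X k) c := by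
  obtain ⟨n, c, hc⟩ := exists_pow_smul_eq_toAway f b
  have : toAway f _ (C.d k c) = 0 := by rw [← awayMap_toAway, ← hc, map_smul, hb, smul_zero]
  obtain ⟨m, hm⟩ := (toAway_eq_zero_iff f).1 this
  refine ⟨m + n, f ^ m • c, ?_, ?_⟩
  · rw [LinearMap.mem_ker, map_smul, hm]
  · rw [pow_add, mul_smul, hc, map_smul]

theorem mem_range_awayMap_of_coboundary {b : ModAway f (C.X k)} {c : C.X k} (n : ℕ)
    (hc : c ∈ C.coboundaries k) (h : f ^ n • b = toAway f (C.X k) c) :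
    ∃ w, awayMap f (C.dPrev k) w = b := by
  obtain ⟨y, rfl⟩ := hc
  obtain ⟨w, hw⟩ := exists_pow_smul_away f n (toAway f _ y)
  refine ⟨w, pow_smul_away_injective f n ?_⟩
  rw [← map_smul, hw, h, awayMap_toAway]

/-- Every cohomology class is killed by a power of `g`. -/
def CohTorsion (C : ModComplex A) (g : A) : Prop :=
  ∀ k, ∀ z ∈ C.cocycles k, ∃ n : ℕ, g ^ n • z ∈ C.coboundaries k

theorem cohTorsion_Fib_self : (C.Fib f).CohTorsion f := by
  intro k z h
  obtain ⟨a, b, rfl⟩ := C.exists_fibMk f z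
  obtain ⟨ha, hab⟩ := (C.mem_cocycles_Fib f).1 h
  obtain ⟨n, y, hy⟩ := exists_pow_smul_eq_toAway f b
  have : toAway f (C.X k) (f ^ n • a - C.dPrev k y) = 0 := by
    rw [map_sub, map_smul, hab, ← map_smul, hy, awayMap_toAway, sub_self]
  obtain ⟨m, hm⟩ := (toAway_eq_zero_iff f).1 this
  refine ⟨m + n, ?_⟩
  have h2 : f ^ (m + n) • C.fibMk f a b =
      f ^ m • C.fibMk f (C.dPrev k y) (toAway f (C.prev k) y) := by
    rw [smul_sub, sub_eq_zero] at hm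
    rw [pow_add, mul_smul, smul_fibMk, smul_fibMk, smul_fibMk, hm, hy]
  rw [h2]
  exact Submodule.smul_mem _ _ (C.mk_mem_coboundaries_Fib f y)

theorem CohTorsion.fib {C : ModComplex A} {g : A} (hC : C.CohTorsion g) (f : A) :
    (C.Fib f).CohTorsion g := by
  intro k z h
  obtain ⟨a, b, rfl⟩ := C.exists_fibMk f z
  obtain ⟨ha, hab⟩ := (C.mem_cocycles_Fib f).1 h
  obtain ⟨n, y, hy⟩ := hC k a ha
  have key : ∃ p : ℕ, g ^ p • C.fibMk f 0 (g ^ n • b - toAway f _ y) ∈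
      (C.Fib f).coboundaries k := by
    have hb : awayMap f (C.dPrev k) (g ^ n • b - toAway f _ y) = 0 := by
      rw [map_sub, map_smul, awayMap_toAway, hy, ← hab, ← map_smul, sub_self]
    revert hb
    generalize g ^ n • b - toAway f _ y = b'
    intro hb
    cases k with
    | zero =>
      refine ⟨0, ?_⟩
      rw [Subsingleton.elim b' 0, fibMk_zero, smul_zero]
      exact Submodule.zero_mem _
    | succ k =>
      change ModAway f (C.X k) at b'
      obtain ⟨m, c, hc, hmc⟩ := C.exists_cocycle_of_away f hb
      obtain ⟨p, hp⟩ := hC k c hc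
      obtain ⟨w, hw⟩ := C.mem_range_awayMap_of_coboundary f (b := g ^ p • b') m hp
        (by rw [smul_comm, hmc, map_smul])
      refine ⟨p, ?_⟩
      have := C.zero_mk_mem_coboundaries_Fib f w
      rw [hw] at this
      have h0 := C.smul_fibMk f (k := k + 1) (g ^ p) 0 b'
      rw [smul_zero] at h0
      exact h0 ▸ this
  obtain ⟨p, hp⟩ := key
  refine ⟨p + n, ?_⟩
  have h2 : g ^ (p + n) • C.fibMk f a b =
      g ^ p • C.fibMk f 0 (g ^ n • b - toAway f _ y) +
        g ^ p • C.fibMk f (C.dPrev k y) (toAway f (C.prev k) y) := by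
    rw [← smul_add, pow_add, mul_smul]
    rw [fibMk_add, zero_add, sub_add_cancel, smul_fibMk, hy]
  rw [h2]
  exact Submodule.add_mem _ hp (Submodule.smul_mem _ _ (C.mk_mem_coboundaries_Fib f y))

theorem mem_coboundaries_of_smul_mem {C : ModComplex A} {x : A} (h : (C.Fib x).Acyclic k)
    {a : C.X k} (ha : a ∈ C.cocycles k) (hx : x • a ∈ C.coboundaries k) :
    a ∈ C.coboundaries k := by
  obtain ⟨y, hy⟩ := hx
  obtain ⟨b, hb⟩ := exists_pow_smul_away x 1 (toAway x _ y)
  refine C.exists_of_mem_coboundaries_Fib x (b := b) (h ((C.mem_cocycles_Fib x).2 ⟨ha, ?_⟩))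
  apply pow_smul_away_injective x 1
  rw [← map_smul, ← map_smul, hb, awayMap_toAway, hy, pow_one]

theorem exists_sub_smul_mem_coboundaries {C : ModComplex A} {x : A} (h : (C.Fib x).Acyclic k)
    (h' : (C.Fib x).Acyclic (k + 1)) {a : C.X k} (ha : a ∈ C.cocycles k) :
    ∃ y ∈ C.cocycles k, a - x • y ∈ C.coboundaries k := by
  obtain ⟨b, hb⟩ := exists_pow_smul_away x 1 (toAway x _ a)
  have hc : C.fibMk x (k := k + 1) 0 b ∈ (C.Fib x).cocycles (k + 1) := by
    refine (C.mem_cocycles_Fib x (k := k + 1)).2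
      ⟨Submodule.zero_mem _, ?_⟩
    change _ = awayMap x (C.d k) b
    apply pow_smul_away_injective x 1
    rw [map_zero, smul_zero, ← map_smul, hb, awayMap_toAway, LinearMap.mem_ker.1 ha, map_zero]
  obtain ⟨y, w, hy, hw⟩ := C.exists_of_mem_coboundaries_Fib_succ x (h' hc)
  refine ⟨y, hy, ?_⟩
  have key : ∃ n : ℕ, x ^ n • (a - x • y) ∈ C.coboundaries k := by
    obtain ⟨n, v, hv⟩ := exists_pow_smul_eq_toAway x w
    have : toAway x _ (x ^ n • (a - x • y) + x • C.dPrev k v) = 0 := by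
      rw [pow_one] at hb
      rw [map_add, map_smul, map_sub, ← hb, ← hw, map_smul, map_smul, ← awayMap_toAway,
        ← hv, map_smul]
      module
    obtain ⟨m, hm⟩ := (toAway_eq_zero_iff x).1 this
    refine ⟨m + n, ?_⟩
    rw [smul_add, ← mul_smul, ← pow_add, add_eq_zero_iff_eq_neg] at hm
    rw [hm]
    exact Submodule.neg_mem _ (Submodule.smul_mem _ _ (Submodule.smul_mem _ _ ⟨v, rfl⟩))
  obtain ⟨n, hn⟩ := key
  induction n with
  | zero => simpa using hn
  | succ n ih =>
    refine ih (mem_coboundaries_of_smul_mem h ?_ ?_)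
    · exact Submodule.smul_mem _ _ (Submodule.sub_mem _ ha (Submodule.smul_mem _ _ hy))
    · rwa [← mul_smul, ← pow_succ']

theorem Fib_acyclic_iff {C : ModComplex A} (f : A) (hC : ∀ k, IsPowTorsion f (C.prev k)) (k : ℕ) :
    (C.Fib f).Acyclic k ↔ C.Acyclic k := by
  have hs : ∀ k, Subsingleton (ModAway f (C.prev k)) := fun k => (hC k).subsingleton f
  have hs' : ∀ k, Subsingleton (ModAway f (C.X k)) := fun k => hs (k + 1)
  constructor
  · intro h a ha
    exact C.exists_of_mem_coboundaries_Fib f (b := 0)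
      (h ((C.mem_cocycles_Fib f).2 ⟨ha, Subsingleton.elim _ _⟩))
  · intro h z hab
    obtain ⟨a, b, rfl⟩ := C.exists_fibMk f z
    obtain ⟨y, rfl⟩ := h ((C.mem_cocycles_Fib f).1 hab).1
    rw [Subsingleton.elim b (toAway f _ y)]
    exact C.mk_mem_coboundaries_Fib f y

/-- The map induced on fibers of localization maps. -/
def Hom.fib {C D : ModComplex A} (φ : Hom C D) (f : A) : Hom (C.Fib f) (D.Fib f) where
  f k := (φ.f k).prodMap (awayMap f (φ.fPrev k))
  comm k x := by
    refine Prod.ext (φ.comm k x.1) ?_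
    change awayMap f (φ.f k) (toAway f _ x.1 - awayMap f (C.dPrev k) x.2) =
      toAway f _ (φ.f k x.1) - awayMap f (D.dPrev k) (awayMap f (φ.fPrev k) x.2)
    rw [map_sub, awayMap_toAway, awayMap_comp, awayMap_comp]
    congr 3
    exact LinearMap.ext (φ.comm_prev k)

theorem IsShortExact.fib {C D E : ModComplex A} {φ : Hom C D} {ψ : Hom D E}
    (h : IsShortExact φ ψ) (f : A) : IsShortExact (φ.fib f) (ψ.fib f) where
  inj k := Prod.map_injective.2 ⟨h.inj k, awayMap_injective f (h.inj_prev k)⟩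
  surj k := Prod.map_surjective.2 ⟨h.surj k, awayMap_surjective f (h.surj_prev k)⟩
  exact k := by
    rintro ⟨a, b⟩
    constructor
    · intro hab
      obtain ⟨a', ha'⟩ := (h.exact k a).1 (congrArg Prod.fst hab)
      obtain ⟨b', hb'⟩ := (awayMap_exact f (h.exact_prev k) b).1 (congrArg Prod.snd hab)
      exact ⟨(a', b'), Prod.ext ha' hb'⟩
    · rintro ⟨⟨a', b'⟩, hab⟩
      exact Prod.ext ((h.exact k a).2 ⟨a', congrArg Prod.fst hab⟩)
        ((awayMap_exact f (h.exact_prev k) b).2 ⟨b', congrArg Prod.snd hab⟩)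

/-- The complex with a single module in degree zero. -/
def single (M : Type u) [AddCommGroup M] [Module A M] : ModComplex A where
  X k := match k with
    | 0 => M
    | _ + 1 => PUnit
  addCommGroup k := match k with
    | 0 => (inferInstance : AddCommGroup M)
    | _ + 1 => (inferInstance : AddCommGroup PUnit.{u + 1})
  module k := match k with
    | 0 => (inferInstance : Module A M)
    | _ + 1 => (PUnit.module : Module A PUnit.{u + 1})
  d _ := 0
  d_d _ _ := rfl

section

variable {M N P : Type u} [AddCommGroup M] [Module A M] [AddCommGroup N] [Module A N]
  [AddCommGroup P] [Module A P]

instance (k : ℕ) : Subsingleton ((single (A := A) M).X (k + 1)) :=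
  inferInstanceAs (Subsingleton PUnit)

/-- The morphism of complexes concentrated in degree zero induced by a linear map. -/
def Hom.single (φ : M →ₗ[A] N) : Hom (single (A := A) M) (ModComplex.single N) where
  f k := match k with
    | 0 => φ
    | _ + 1 => (0 : PUnit.{u + 1} →ₗ[A] PUnit.{u + 1})
  comm _ _ := Subsingleton.elim _ _

theorem isShortExact_single {φ : M →ₗ[A] N} {ψ : N →ₗ[A] P} (hi : Function.Injective φ)
    (he : Function.Exact φ ψ) (hs : Function.Surjective ψ) :
    IsShortExact (Hom.single φ) (Hom.single ψ) where
  inj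
  | 0 => hi
  | _ + 1 => fun _ _ _ => Subsingleton.elim (α := PUnit) _ _
  exact
  | 0 => he
  | _ + 1 => fun x => ⟨fun _ => ⟨x, Subsingleton.elim (α := PUnit) _ _⟩,
      fun _ => Subsingleton.elim (α := PUnit) _ _⟩
  surj
  | 0 => hs
  | _ + 1 => fun _ => ⟨0, Subsingleton.elim (α := PUnit) _ _⟩

end

end ModComplex

/-! ### Čech complexes of modules -/

open ModComplex

section Cech

variable {A : Type u} [CommRing A] (L : List A) (M : Type u)
variable {N P : Type u} [AddCommGroup M] [Module A M] [AddCommGroup N] [Module A N]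
  [AddCommGroup P] [Module A P]

/-- The (extended) Čech complex of `M` with respect to a list of ring elements. -/
def Cech : List A → ModComplex A
  | [] => single M
  | f :: L => (Cech L).Fib f

variable {M}

/-- The morphism of Čech complexes induced by a linear map. -/
def cechMap (φ : M →ₗ[A] N) : ∀ L : List A, Hom (Cech M L) (Cech N L)
  | [] => Hom.single φ
  | f :: L => (cechMap φ L).fib f

theorem isShortExact_cechMap {φ : M →ₗ[A] N} {ψ : N →ₗ[A] P} (hi : Function.Injective φ)
    (he : Function.Exact φ ψ) (hs : Function.Surjective ψ) :
    ∀ L : List A, IsShortExact (cechMap φ L) (cechMap ψ L)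
  | [] => isShortExact_single hi he hs
  | f :: L => (isShortExact_cechMap hi he hs L).fib f

theorem ModComplex.Hom.fPrev_add {C D : ModComplex A} {φ ψ χ : Hom C D}
    (h : ∀ k, χ.f k = φ.f k + ψ.f k) : ∀ k, χ.fPrev k = φ.fPrev k + ψ.fPrev k
  | 0 => Subsingleton.elim _ _
  | k + 1 => h k

theorem ModComplex.Hom.fPrev_smul {C D : ModComplex A} {φ χ : Hom C D} {r : A}
    (h : ∀ k, χ.f k = r • φ.f k) : ∀ k, χ.fPrev k = r • φ.fPrev k
  | 0 => Subsingleton.elim _ _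
  | k + 1 => h k

theorem ModComplex.Hom.fPrev_comp {C D E : ModComplex A} {φ : Hom C D} {ψ : Hom D E} {χ : Hom C E}
    (h : ∀ k, χ.f k = ψ.f k ∘ₗ φ.f k) : ∀ k, χ.fPrev k = ψ.fPrev k ∘ₗ φ.fPrev k
  | 0 => Subsingleton.elim _ _
  | k + 1 => h k

theorem cechMap_add (φ ψ : M →ₗ[A] N) : ∀ (L : List A) (k : ℕ),
    (cechMap (φ + ψ) L).f k = (cechMap φ L).f k + (cechMap ψ L).f k
  | [], 0 => rfl
  | [], _ + 1 => LinearMap.ext fun _ => Subsingleton.elim (α := PUnit) _ _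
  | f :: L, k => by
    change LinearMap.prodMap _ _ = LinearMap.prodMap _ _ + LinearMap.prodMap _ _
    rw [cechMap_add φ ψ L, Hom.fPrev_add (cechMap_add φ ψ L), awayMap_add]
    rfl

theorem cechMap_smul (r : A) (φ : M →ₗ[A] N) : ∀ (L : List A) (k : ℕ),
    (cechMap (r • φ) L).f k = r • (cechMap φ L).f k
  | [], 0 => rfl
  | [], _ + 1 => LinearMap.ext fun _ => Subsingleton.elim (α := PUnit) _ _
  | f :: L, k => by
    change LinearMap.prodMap _ _ = r • LinearMap.prodMap _ _
    rw [cechMap_smul r φ L, Hom.fPrev_smul (cechMap_smul r φ L), awayMap_smul]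
    rfl

theorem cechMap_comp (φ : M →ₗ[A] N) (ψ : N →ₗ[A] P) : ∀ (L : List A) (k : ℕ),
    (cechMap (ψ ∘ₗ φ) L).f k = (cechMap ψ L).f k ∘ₗ (cechMap φ L).f k
  | [], 0 => rfl
  | [], _ + 1 => LinearMap.ext fun _ => Subsingleton.elim (α := PUnit) _ _
  | f :: L, k => by
    refine LinearMap.ext fun x => Prod.ext ?_ ?_
    · change (cechMap (ψ ∘ₗ φ) L).f k x.1 = _
      rw [cechMap_comp φ ψ L]
      rfl
    · change awayMap f ((cechMap (ψ ∘ₗ φ) L).fPrev k) x.2 =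
        awayMap f ((cechMap ψ L).fPrev k) (awayMap f ((cechMap φ L).fPrev k) x.2)
      rw [Hom.fPrev_comp (cechMap_comp φ ψ L), awayMap_comp]

/-- The action of linear maps on Čech cohomology. -/
def cechH (L : List A) (k : ℕ) : (M →ₗ[A] N) →ₗ[A] ((Cech M L).H k →ₗ[A] (Cech N L).H k) where
  toFun φ := (cechMap φ L).mapH k
  map_add' φ ψ := by
    refine LinearMap.ext fun z => ?_
    obtain ⟨x, rfl⟩ := cls_surjective _ k z
    rw [LinearMap.add_apply, Hom.mapH_cls, Hom.mapH_cls, Hom.mapH_cls, ← map_add]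
    congr 1
    exact Subtype.ext (congrArg (fun g => g x.1) (cechMap_add φ ψ L k))
  map_smul' r φ := by
    refine LinearMap.ext fun z => ?_
    obtain ⟨x, rfl⟩ := cls_surjective _ k z
    rw [RingHom.id_apply, LinearMap.smul_apply, Hom.mapH_cls, Hom.mapH_cls, ← map_smul]
    congr 1
    exact Subtype.ext (congrArg (fun g => g x.1) (cechMap_smul r φ L k))

theorem cechH_apply (k : ℕ) (φ : M →ₗ[A] N) : cechH L k φ = (cechMap φ L).mapH k := rfl

theorem cechH_comp (k : ℕ) (φ : M →ₗ[A] N) (ψ : N →ₗ[A] P) :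
    cechH L k (ψ ∘ₗ φ) = cechH L k ψ ∘ₗ cechH L k φ := by
  refine LinearMap.ext fun z => ?_
  obtain ⟨x, rfl⟩ := cls_surjective _ k z
  simp only [cechH_apply, LinearMap.comp_apply, Hom.mapH_cls]
  congr 1
  exact Subtype.ext (congrArg (fun g => g x.1) (cechMap_comp φ ψ L k))

theorem cechMap_id : ∀ (L : List A) (k : ℕ),
    (cechMap (LinearMap.id : M →ₗ[A] M) L).f k = LinearMap.id
  | [], 0 => rfl
  | [], _ + 1 => LinearMap.ext fun _ => Subsingleton.elim (α := PUnit) _ _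
  | f :: L, k => by
    have : ∀ k, (cechMap (LinearMap.id : M →ₗ[A] M) L).fPrev k = LinearMap.id := fun k => by
      cases k with
      | zero => exact Subsingleton.elim _ _
      | succ k => exact cechMap_id L k
    refine LinearMap.ext fun x => Prod.ext ?_ ?_
    · change (cechMap (LinearMap.id : M →ₗ[A] M) L).f k x.1 = x.1
      rw [cechMap_id L]
      rfl
    · change awayMap f ((cechMap (LinearMap.id : M →ₗ[A] M) L).fPrev k) x.2 = x.2
      rw [this]
      simp [awayMap]

theorem cechH_id (k : ℕ) : cechH L k (LinearMap.id : M →ₗ[A] M) = LinearMap.id := by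
  refine LinearMap.ext fun z => ?_
  obtain ⟨x, rfl⟩ := cls_surjective _ k z
  simp only [cechH_apply, Hom.mapH_cls, LinearMap.id_apply]
  congr 1
  exact Subtype.ext (congrArg (fun g => g x.1) (cechMap_id L k))

theorem cechAcyclic_of_equiv {L : List A} {k : ℕ} (e : M ≃ₗ[A] N) (h : (Cech M L).Acyclic k) :
    (Cech N L).Acyclic k := by
  rw [acyclic_iff] at *
  intro z
  have : cechH L k (e.toLinearMap ∘ₗ e.symm.toLinearMap) z = z := by
    rw [LinearEquiv.comp_symm, cechH_id, LinearMap.id_apply]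
  rw [← this, cechH_comp, LinearMap.comp_apply, h (cechH L k e.symm.toLinearMap z), map_zero]

theorem cech_acyclic_of_subsingleton [Subsingleton M] (L : List A) (k : ℕ) :
    (Cech M L).Acyclic k := by
  rw [acyclic_iff]
  intro z
  rw [← LinearMap.id_apply (R := A) z, ← cechH_id, Subsingleton.elim LinearMap.id 0, map_zero,
    LinearMap.zero_apply]

/-- The augmentation identifying `M` with the degree zero term of its Čech complex. -/
def cechAug : ∀ L : List A, M ≃ₗ[A] (Cech M L).X 0
  | [] => LinearEquiv.refl A M
  | f :: L => (cechAug L).trans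
    { LinearMap.inl A ((Cech M L).X 0) (ModAway f ((Cech M L).prev 0)) with
      invFun := Prod.fst
      left_inv := fun _ => rfl
      right_inv := fun _ => Prod.ext rfl (Subsingleton.elim _ _) }

theorem cechAug_mem_cocycles {x : M} : ∀ {L : List A},
    cechAug L x ∈ (Cech M L).cocycles 0 ↔ ∀ f ∈ L, ∃ n : ℕ, f ^ n • x = 0
  | [] => by
    simp only [List.not_mem_nil, false_imp_iff, implies_true, iff_true]
    rfl
  | f :: L => by
    have h1 : cechAug (f :: L) x = (Cech M L).fibMk f (cechAug L x) 0 := rfl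
    rw [h1, List.forall_mem_cons, ← cechAug_mem_cocycles, and_comm]
    refine ((Cech M L).mem_cocycles_Fib f).trans (and_congr_right fun _ => ?_)
    rw [map_zero, toAway_eq_zero_iff]
    refine exists_congr fun n => ?_
    rw [← map_smul, map_eq_zero_iff _ (cechAug L).injective]

theorem cechAug_natural (φ : M →ₗ[A] N) (x : M) : ∀ L : List A,
    (cechMap φ L).f 0 (cechAug L x) = cechAug L (φ x)
  | [] => rfl
  | _ :: L => Prod.ext (cechAug_natural φ x L) (Subsingleton.elim _ _)

theorem coboundaries_zero (C : ModComplex A) : C.coboundaries 0 = ⊥ := LinearMap.range_zero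

theorem cech_acyclic_zero_iff : (Cech M L).Acyclic 0 ↔
    ∀ x : M, (∀ f ∈ L, ∃ n : ℕ, f ^ n • x = 0) → x = 0 := by
  unfold Acyclic
  rw [coboundaries_zero, le_bot_iff, Submodule.eq_bot_iff]
  constructor
  · intro h x hx
    exact (map_eq_zero_iff _ (cechAug L).injective).1 (h _ (cechAug_mem_cocycles.2 hx))
  · intro h z hz
    obtain ⟨x, rfl⟩ := (cechAug L).surjective z
    rw [h x (cechAug_mem_cocycles.1 hz), map_zero]

theorem subsingleton_cech_X : ∀ (L : List A) {k : ℕ}, L.length < k →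
    Subsingleton ((Cech M L).X k)
  | [], 0, h => absurd h (lt_irrefl _)
  | [], _ + 1, _ => inferInstanceAs (Subsingleton PUnit)
  | _ :: _, 0, h => absurd h (Nat.not_lt_zero _)
  | f :: L, k + 1, h => by
    have h1 : L.length < k := by simpa using h
    have h2 := subsingleton_cech_X L h1
    have h3 := subsingleton_cech_X L (h1.trans k.lt_succ_self)
    have h4 : Subsingleton (ModAway f ((Cech M L).prev (k + 1))) :=
      (IsPowTorsion.of_subsingleton (M := (Cech M L).X k) f).subsingleton f
    exact inferInstanceAs
      (Subsingleton ((Cech M L).X (k + 1) × ModAway f ((Cech M L).prev (k + 1))))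

theorem cech_acyclic_of_length_lt {L : List A} {k : ℕ} (h : L.length < k) :
    (Cech M L).Acyclic k := by
  have := subsingleton_cech_X (M := M) L h
  intro x _
  rw [Subsingleton.elim x 0]
  exact Submodule.zero_mem _

theorem cech_cohTorsion : ∀ {L : List A} {f : A}, f ∈ L → (Cech M L).CohTorsion f
  | f :: _, _, h => by
    rcases List.mem_cons.1 h with rfl | h
    · exact cohTorsion_Fib_self _ _
    · exact (cech_cohTorsion h).fib f

theorem IsPowTorsion.prev {f : A} {C : ModComplex A} (h : ∀ k, IsPowTorsion f (C.X k)) :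
    ∀ k, IsPowTorsion f (C.prev k)
  | 0 => IsPowTorsion.of_subsingleton f
  | k + 1 => h k

theorem IsPowTorsion.cech {f : A} (h : IsPowTorsion f M) : ∀ (L : List A) (k : ℕ),
    IsPowTorsion f ((Cech M L).X k)
  | [], 0 => h
  | [], _ + 1 => IsPowTorsion.of_subsingleton (M := PUnit) f
  | _ :: L, k => (h.cech L k).prod _ (IsPowTorsion.away f (IsPowTorsion.prev (h.cech L) k))

theorem cech_cons_acyclic_iff {f : A} (h : IsPowTorsion f M) (L : List A) (k : ℕ) :
    (Cech M (f :: L)).Acyclic k ↔ (Cech M L).Acyclic k :=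
  Fib_acyclic_iff f (IsPowTorsion.prev (h.cech L)) k

theorem cech_append_acyclic_iff (L' : List A) (k : ℕ) : ∀ L : List A,
    (∀ f ∈ L, IsPowTorsion f M) → ((Cech M (L ++ L')).Acyclic k ↔ (Cech M L').Acyclic k)
  | [], _ => Iff.rfl
  | f :: L, h => by
    rw [List.cons_append, cech_cons_acyclic_iff (h f List.mem_cons_self),
      cech_append_acyclic_iff L' k L fun g hg => h g (List.mem_cons_of_mem _ hg)]

theorem cech_acyclic_of_torsion (h : ∀ f ∈ L, IsPowTorsion f M) {k : ℕ} (hk : 0 < k) :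
    (Cech M L).Acyclic k := by
  rw [← List.append_nil L, cech_append_acyclic_iff [] k L h]
  exact cech_acyclic_of_length_lt hk

end Cech

/-! ### Čech cohomology of injective modules -/

section Injective

variable {A : Type u} [CommRing A] {G : Type u} [AddCommGroup G] [Module A G]

theorem Module.Baer.exists_extend (hG : Module.Baer A G) {W : Type u} [AddCommGroup W] [Module A W]
    (p : W →ₗ[A] A) (q : W →ₗ[A] G) (h : LinearMap.ker p ≤ LinearMap.ker q) :
    ∃ g : A →ₗ[A] G, ∀ w, g (p w) = q w := by
  obtain ⟨δ, hδ⟩ := LinearMap.exists_comp_eq p.rangeRestrict q p.surjective_rangeRestrict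
    (by rwa [LinearMap.ker_rangeRestrict])
  obtain ⟨g, hg⟩ := hG (LinearMap.range p) δ
  exact ⟨g, fun w => (hg _ ⟨w, rfl⟩).trans (hδ w)⟩

/-- The elements killed by a power of `f`. -/
def powTorsion (f : A) (G : Type u) [AddCommGroup G] [Module A G] : Submodule A G where
  carrier := {x | ∃ n : ℕ, f ^ n • x = 0}
  zero_mem' := ⟨0, smul_zero _⟩
  add_mem' := by
    rintro x y ⟨m, hm⟩ ⟨n, hn⟩
    refine ⟨m + n, ?_⟩
    rw [smul_add, pow_add, mul_smul, mul_smul, hn, smul_comm, hm, smul_zero, smul_zero, add_zero]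
  smul_mem' := by
    rintro r x ⟨n, hn⟩
    exact ⟨n, by rw [smul_comm, hn, smul_zero]⟩

theorem exists_pow_smul_eq_zero_of_fg {f : A} (S : Submodule A G) (hS : S.FG)
    (h : ∀ x ∈ S, ∃ n : ℕ, f ^ n • x = 0) : ∃ n : ℕ, ∀ x ∈ S, f ^ n • x = 0 := by
  induction S, hS using Submodule.fg_induction with
  | singleton x =>
    obtain ⟨n, hn⟩ := h x (Submodule.mem_span_singleton_self x)
    refine ⟨n, fun y hy => ?_⟩
    obtain ⟨r, rfl⟩ := Submodule.mem_span_singleton.1 hy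
    rw [smul_comm, hn, smul_zero]
  | sup S T _ _ hS hT =>
    obtain ⟨m, hm⟩ := hS fun x hx => h x (Submodule.mem_sup_left hx)
    obtain ⟨n, hn⟩ := hT fun x hx => h x (Submodule.mem_sup_right hx)
    refine ⟨m + n, fun x hx => ?_⟩
    obtain ⟨y, hy, z, hz, rfl⟩ := Submodule.mem_sup.1 hx
    rw [smul_add, pow_add, mul_smul, mul_smul, hn z hz, smul_comm, hm y hy, smul_zero, smul_zero,
      add_zero]

variable [IsNoetherianRing A]

theorem toAway_surjective_of_baer (hG : Module.Baer A G) (f : A) :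
    Function.Surjective (toAway f G) := by
  intro z
  obtain ⟨n, x, hx⟩ := exists_pow_smul_eq_toAway f z
  let I : ℕ →o Ideal A :=
    ⟨fun k => LinearMap.ker (LinearMap.mulRight A (f ^ k)), by
      refine monotone_nat_of_le_succ fun k r hr => ?_
      rw [LinearMap.mem_ker, LinearMap.mulRight_apply] at *
      rw [pow_succ, ← mul_assoc, hr, zero_mul]⟩
  obtain ⟨N, hN⟩ := monotone_stabilizes_iff_noetherian.2 ‹IsNoetherianRing A› I
  obtain ⟨g, hg⟩ := hG.exists_extend (LinearMap.mulRight A (f ^ (N + n)))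
    (LinearMap.toSpanSingleton A G (f ^ N • x)) (by
      change I (N + n) ≤ _
      rw [← hN _ (Nat.le_add_right N n)]
      intro r hr
      change r • f ^ N • x = 0
      rw [← mul_smul]
      change r * f ^ N = 0 at hr
      rw [hr, zero_smul])
  refine ⟨g 1, pow_smul_away_injective f (N + n) ?_⟩
  have h1 := hg 1
  rw [LinearMap.mulRight_apply, LinearMap.toSpanSingleton_apply, one_smul, one_mul,
    ← mul_one (f ^ (N + n)), ← smul_eq_mul, map_smul] at h1
  rw [← map_smul, h1, map_smul, ← hx, pow_add, mul_smul]

theorem Module.Baer.powTorsion (hG : Module.Baer A G) (f : A) :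
    Module.Baer A (powTorsion f G) := by
  intro I φ
  obtain ⟨n, hn⟩ := exists_pow_smul_eq_zero_of_fg (f := f) (LinearMap.range φ)
    (by rw [LinearMap.range_eq_map]; exact (Module.Finite.fg_top (R := A) (M := I)).map φ)
    (by
      rintro _ ⟨x, rfl⟩
      obtain ⟨n, hn⟩ := (φ x).2
      exact ⟨n, Subtype.ext hn⟩)
  obtain ⟨k, hk⟩ := Ideal.exists_pow_inf_eq_pow_smul (Ideal.span {f}) (M := A) I
  have hker : ∀ (x : I) (r : A), (x : A) = r * f ^ (n + k) → φ x = 0 := by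
    intro x r hx
    have h1 : (x : A) ∈ Ideal.span {f} ^ (n + k) • (⊤ : Submodule A A) ⊓ I := by
      refine ⟨?_, x.2⟩
      rw [Ideal.span_singleton_pow, smul_eq_mul, Ideal.mul_top, hx]
      exact Ideal.mul_mem_left _ _ (Ideal.mem_span_singleton_self _)
    rw [hk _ (Nat.le_add_left k n), Nat.add_sub_cancel, Ideal.span_singleton_pow] at h1
    rw [Submodule.ideal_span_singleton_smul] at h1
    obtain ⟨y, hy, hyx⟩ := (Submodule.mem_smul_pointwise_iff_exists _ _ _).1 h1
    have : x = f ^ n • (⟨y, hy.2⟩ : I) := Subtype.ext hyx.symm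
    rw [this, map_smul]
    exact hn _ ⟨_, rfl⟩
  obtain ⟨g, hg⟩ := hG.exists_extend
    (I.subtype.coprod (LinearMap.mulRight A (f ^ (n + k))))
    ((Submodule.subtype _ ∘ₗ φ) ∘ₗ LinearMap.fst A I A) (by
      rintro ⟨x, r⟩ hx
      have : (x : A) + r * f ^ (n + k) = 0 := hx
      have h2 := hker x (-r) (by rw [neg_mul, eq_neg_iff_add_eq_zero, this])
      exact congrArg Subtype.val h2)
  have hg1 : f ^ (n + k) • g 1 = 0 := by
    have := hg (0, 1)
    rw [LinearMap.coprod_apply, map_zero, zero_add, LinearMap.mulRight_apply, one_mul,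
      ← mul_one (f ^ (n + k)), ← smul_eq_mul, map_smul] at this
    simpa using this
  refine ⟨g.codRestrict _ fun r => ⟨n + k, ?_⟩, fun x hx => Subtype.ext ?_⟩
  · rw [← mul_one r, ← smul_eq_mul, map_smul, smul_comm, hg1, smul_zero]
  · have := hg (⟨x, hx⟩, 0)
    rw [LinearMap.coprod_apply, map_zero, add_zero] at this
    exact this

theorem ModComplex.fib_of_injective {C : ModComplex A} (f : A) (hC : ∀ k, C.Acyclic (k + 1))
    (h0 : Module.Baer A (C.cocycles 0)) :
    (∀ k, (C.Fib f).Acyclic (k + 1)) ∧ Module.Baer A ((C.Fib f).cocycles 0) := by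
  constructor
  · intro k z hz
    obtain ⟨a, b, rfl⟩ := C.exists_fibMk f z
    change ModAway f (C.X k) at b
    obtain ⟨ha, hab⟩ := (C.mem_cocycles_Fib f (k := k + 1)).1 hz
    obtain ⟨(y : C.X k), rfl⟩ := hC k ha
    have hb : awayMap f (C.d k) (b - toAway f _ y) = 0 := by
      rw [map_sub, awayMap_toAway, sub_eq_zero]
      exact hab.symm
    have key : ∃ (c : C.X k) (w : ModAway f (C.prev k)), c ∈ C.cocycles k ∧
        b - toAway f _ y = toAway f _ c + awayMap f (C.dPrev k) w := by
      obtain ⟨n, c, hc, hbc⟩ := C.exists_cocycle_of_away f hb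
      cases k with
      | zero =>
        obtain ⟨z, hz⟩ := exists_pow_smul_away f n (toAway f (C.cocycles 0) ⟨c, hc⟩)
        obtain ⟨c', rfl⟩ := toAway_surjective_of_baer h0 f z
        refine ⟨c', 0, c'.2, ?_⟩
        rw [map_zero, add_zero]
        apply pow_smul_away_injective f n
        have := congrArg (awayMap f (C.cocycles 0).subtype) hz
        rw [map_smul, awayMap_toAway, awayMap_toAway] at this
        rw [hbc]
        exact this.symm
      | succ k =>
        obtain ⟨w, hw⟩ := C.mem_range_awayMap_of_coboundary f n (hC k hc) hbc
        exact ⟨0, w, Submodule.zero_mem _, by rw [hw, map_zero, zero_add]⟩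
    obtain ⟨c, w, hc, hw⟩ := key
    refine ⟨C.fibMk f (y + c) (-w), ?_⟩
    change C.fibMk f (k := k + 1) (C.d k (y + c))
      (toAway f (C.X k) (y + c) - awayMap f (C.dPrev k) (-w)) = _
    refine (C.fibMk_inj f).2 ⟨?_, ?_⟩
    · rw [map_add, LinearMap.mem_ker.1 hc, add_zero]
      rfl
    · rw [map_neg, sub_neg_eq_add, map_add, add_assoc, ← hw, add_sub_cancel]
  · let φ : (C.Fib f).cocycles 0 →ₗ[A] powTorsion f (C.cocycles 0) :=
      { toFun := fun z => ⟨⟨z.1.1, ((C.mem_cocycles_Fib f).1 z.2).1⟩, by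
          obtain ⟨⟨a, b⟩, hz⟩ := z
          have := ((C.mem_cocycles_Fib f).1 hz).2
          rw [Subsingleton.elim b 0, map_zero, toAway_eq_zero_iff] at this
          obtain ⟨n, hn⟩ := this
          exact ⟨n, Subtype.ext hn⟩⟩
        map_add' := fun _ _ => rfl
        map_smul' := fun _ _ => rfl }
    have hφ : Function.Bijective φ := by
      constructor
      · rintro ⟨⟨a, b⟩, hz⟩ ⟨⟨a', b'⟩, hz'⟩ h
        have : a = a' := congrArg (fun z => z.1.1) h
        exact Subtype.ext (Prod.ext this (Subsingleton.elim (α := ModAway f (C.prev 0)) _ _))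
      · rintro ⟨⟨a, ha⟩, n, hn⟩
        refine ⟨⟨C.fibMk f a 0, (C.mem_cocycles_Fib f).2 ⟨ha, ?_⟩⟩, rfl⟩
        rw [map_zero, toAway_eq_zero_iff]
        exact ⟨n, congrArg Subtype.val hn⟩
    exact (h0.powTorsion f).of_equiv (LinearEquiv.ofBijective φ hφ).symm

theorem cech_of_injective (hG : Module.Baer A G) : ∀ L : List A,
    (∀ k, (Cech G L).Acyclic (k + 1)) ∧ Module.Baer A ((Cech G L).cocycles 0)
  | [] => by
    refine ⟨fun k => cech_acyclic_of_length_lt k.succ_pos, ?_⟩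
    have : (Cech G ([] : List A)).cocycles 0 = ⊤ := LinearMap.ker_zero
    rw [this]
    let e : G ≃ₗ[A] (⊤ : Submodule A G) := (Submodule.topEquiv (R := A) (M := G)).symm
    exact Module.Baer.of_equiv e hG
  | f :: L => ModComplex.fib_of_injective f (cech_of_injective hG L).1 (cech_of_injective hG L).2

end Injective

/-! ### Vanishing of Čech cohomology and socles -/

section Vanishing

variable {A : Type u} [CommRing A]

theorem exists_smul_ne_zero_of_torsion {H : Type u} [AddCommGroup H] [Module A H] :
    ∀ (L : List A), (∀ f ∈ L, ∀ z : H, ∃ n : ℕ, f ^ n • z = 0) → ∀ z : H, z ≠ 0 →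
      ∃ r : A, r • z ≠ 0 ∧ ∀ f ∈ L, f • r • z = 0
  | [], _, z, hz => ⟨1, by rwa [one_smul], by simp⟩
  | f :: L, h, z, hz => by
    classical
    obtain ⟨r, hr, hrL⟩ := exists_smul_ne_zero_of_torsion L
      (fun g hg => h g (List.mem_cons_of_mem _ hg)) z hz
    have hex := h f List.mem_cons_self (r • z)
    obtain ⟨n, hn⟩ : ∃ n, Nat.find hex = n + 1 := by
      refine Nat.exists_eq_succ_of_ne_zero fun h0 => hr ?_
      have := Nat.find_spec hex
      rwa [h0, pow_zero, one_smul] at this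
    refine ⟨f ^ n * r, ?_, ?_⟩
    · rw [mul_smul]
      exact Nat.find_min hex (by omega)
    · rw [List.forall_mem_cons]
      constructor
      · have := Nat.find_spec hex
        rwa [hn, pow_succ', mul_smul, ← mul_smul (f ^ n)] at this
      · intro g hg
        rw [mul_smul, smul_comm g, hrL g hg, smul_zero]

theorem cech_exists_pow_smul_eq_zero {M : Type u} [AddCommGroup M] [Module A M] {L : List A} {f : A}
    (hf : f ∈ L) (k : ℕ) (z : (Cech M L).H k) : ∃ n : ℕ, f ^ n • z = 0 := by
  obtain ⟨x, rfl⟩ := ModComplex.cls_surjective _ k z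
  obtain ⟨n, hn⟩ := cech_cohTorsion hf k x.1 x.2
  exact ⟨n, (ModComplex.cls_eq_zero _ (x := f ^ n • x)).2 hn⟩

theorem cech_acyclic_of_socle {M : Type u} [AddCommGroup M] [Module A M] {L : List A} {k : ℕ}
    (h : ∀ z : (Cech M L).H k, (∀ f ∈ L, f • z = 0) → z = 0) : (Cech M L).Acyclic k := by
  rw [ModComplex.acyclic_iff]
  intro z
  by_contra hz
  obtain ⟨r, hr, hrL⟩ := exists_smul_ne_zero_of_torsion L
    (fun f hf => cech_exists_pow_smul_eq_zero hf k) z hz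
  exact hr (h _ hrL)

variable [IsNoetherianRing A]

theorem exists_regular_of_acyclic_zero {M : Type u} [AddCommGroup M] [Module A M]
    [Module.Finite A M] {L : List A} (h : (Cech M L).Acyclic 0) :
    ∃ y ∈ Ideal.span {f | f ∈ L}, IsSMulRegular M y := by
  have h' := (cech_acyclic_zero_iff L).1 h
  have hs : Subsingleton ((A ⧸ Ideal.span {f | f ∈ L}) →ₗ[A] M) := by
    refine subsingleton_of_forall_eq 0 fun φ => ?_
    refine LinearMap.ext fun z => ?_
    rw [LinearMap.zero_apply]
    refine h' _ fun f hf => ⟨1, ?_⟩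
    rw [pow_one, ← map_smul]
    obtain ⟨r, rfl⟩ := Ideal.Quotient.mk_surjective z
    have : f • (Ideal.Quotient.mk (Ideal.span {f | f ∈ L}) r) = 0 := by
      rw [← Ideal.Quotient.mk_eq_mk, ← Submodule.Quotient.mk_smul,
        Ideal.Quotient.mk_eq_mk, Ideal.Quotient.eq_zero_iff_mem]
      exact Ideal.mul_mem_right _ _ (Ideal.subset_span hf)
    rw [this, map_zero]
  obtain ⟨y, hy, hreg⟩ := IsSMulRegular.subsingleton_linearMap_iff.1 hs
  rw [Ideal.annihilator_quotient] at hy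
  exact ⟨y, hy, hreg⟩

/-- The first nonvanishing Čech cohomology module of a finite module has finite socle. -/
theorem exists_fg_socle (L : List A) : ∀ (g : ℕ) (M : Type u) [AddCommGroup M] [Module A M]
    [Module.Finite A M], (∀ i < g, (Cech M L).Acyclic i) →
    ∃ W : Submodule A ((Cech M L).H g), W.FG ∧ ∀ z, (∀ f ∈ L, f • z = 0) → z ∈ W
  | 0, M, _, _, _, _ => by
    have h1 : IsNoetherian A ((Cech M L).X 0) :=
      isNoetherian_of_linearEquiv (cechAug (M := M) L)
    exact ⟨⊤, IsNoetherian.noetherian _, fun _ _ => trivial⟩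
  | g + 1, M, _, _, _, h => by
    obtain ⟨y, hy, hreg⟩ := exists_regular_of_acyclic_zero (h 0 g.succ_pos)
    let φ : M →ₗ[A] M := LinearMap.lsmul A M y
    have hS := isShortExact_cechMap (φ := φ) (ψ := (LinearMap.range φ).mkQ) hreg
      (LinearMap.exact_map_mkQ_range φ) (Submodule.mkQ_surjective _) L
    obtain ⟨W, hW, hWs⟩ := exists_fg_socle L g (M ⧸ LinearMap.range φ) fun i hi =>
      hS.acyclic_right (h i (by omega)) (h (i + 1) (by omega))
    obtain ⟨δ, hδ, hδ'⟩ := hS.exists_delta g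
    refine ⟨W.map δ, hW.map δ, fun z hz => ?_⟩
    have hyz : (cechMap φ L).mapH (g + 1) z = 0 := by
      have h1 : φ = y • LinearMap.id := rfl
      rw [← cechH_apply, h1, map_smul, cechH_id, LinearMap.smul_apply, LinearMap.id_apply]
      have : Ideal.span {f | f ∈ L} ≤ LinearMap.ker (LinearMap.toSpanSingleton A _ z) :=
        Ideal.span_le.2 hz
      exact this hy
    obtain ⟨w, rfl⟩ := (hδ' z).1 hyz
    refine ⟨w, hWs w fun f hf => ?_, rfl⟩
    have h0 : δ (f • w) = 0 := by rw [map_smul, hz f hf]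
    obtain ⟨v, hv⟩ := (hδ _).1 h0
    rw [← hv, (ModComplex.acyclic_iff _).1 (h g g.lt_succ_self) v, map_zero]

/-- Vanishing of the top Čech cohomology passes to modules with larger annihilator. -/
theorem cech_acyclic_of_annihilator_le {L : List A} {e : ℕ} (M : Type u) [AddCommGroup M]
    [Module A M] [Module.Finite A M] (hM : (Cech M L).Acyclic e)
    (htop : ∀ (N : Type u) [AddCommGroup N] [Module A N] [Module.Finite A N],
      Module.annihilator A M ≤ Module.annihilator A N → (Cech N L).Acyclic (e + 1)) :
    ∀ (N : Type u) [AddCommGroup N] [Module A N] [Module.Finite A N],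
      Module.annihilator A M ≤ Module.annihilator A N → (Cech N L).Acyclic e := by
  suffices H : ∀ (J : Ideal A) (N : Type u) [AddCommGroup N] [Module A N] [Module.Finite A N],
      J ≤ Module.annihilator A N → Module.annihilator A M ≤ Module.annihilator A N →
      (Cech N L).Acyclic e from fun N _ _ _ hN => H ⊥ N bot_le hN
  intro J
  induction J using WellFoundedGT.induction with
  | ind J IH =>
  intro N _ _ hN
  induction hN using IsNoetherianRing.induction_on_isQuotientEquivQuotientPrime A with
  | subsingleton N => exact fun _ _ => cech_acyclic_of_subsingleton L e
  | quotient N p f =>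
    intro hJ hMN
    rw [f.annihilator_eq, Ideal.annihilator_quotient] at hJ hMN
    refine cechAcyclic_of_equiv f.symm ?_
    have hann : Module.annihilator A (A ⧸ p.asIdeal) = p.asIdeal := Ideal.annihilator_quotient
    rcases hJ.lt_or_eq with hlt | rfl
    · exact IH _ hlt _ hann.ge (hMN.trans hann.ge)
    obtain ⟨φ, hφ⟩ : ∃ φ : M →ₗ[A] A ⧸ p.asIdeal, φ ≠ 0 := by
      by_contra! hall
      obtain ⟨r, hr, hreg⟩ :=
        (IsSMulRegular.subsingleton_linearMap_iff (M := A ⧸ p.asIdeal) (N := M)).1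
          (subsingleton_of_forall_eq 0 hall)
      have : (1 : A ⧸ p.asIdeal) = 0 := hreg (by
        change r • (1 : A ⧸ p.asIdeal) = r • 0
        rw [smul_zero]
        exact Module.mem_annihilator.1 (hann.ge (hMN hr)) 1)
      exact one_ne_zero this
    have hS := isShortExact_cechMap (φ := (LinearMap.ker φ).subtype) (ψ := φ.rangeRestrict)
      Subtype.val_injective
      (LinearMap.exact_iff.2 (by rw [LinearMap.ker_rangeRestrict, Submodule.range_subtype]))
      φ.surjective_rangeRestrict L
    have hS' := isShortExact_cechMap (φ := (LinearMap.range φ).subtype)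
      (ψ := (LinearMap.range φ).mkQ) Subtype.val_injective
      (LinearMap.exact_subtype_mkQ _) (Submodule.mkQ_surjective _) L
    refine hS'.acyclic_mid (hS.acyclic_right hM (htop _ ?_)) ?_
    · exact LinearMap.annihilator_le_of_injective (LinearMap.ker φ).subtype Subtype.val_injective
    · have h1 : p.asIdeal ≤ Module.annihilator A ((A ⧸ p.asIdeal) ⧸ LinearMap.range φ) :=
        hann.ge.trans (LinearMap.annihilator_le_of_surjective _ (Submodule.mkQ_surjective _))
      refine IH _ (h1.lt_of_not_ge fun h2 => hφ ?_) _ le_rfl (hMN.trans h1)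
      refine LinearMap.ext fun m => ?_
      obtain ⟨r, hr⟩ := Ideal.Quotient.mk_surjective (φ m)
      rw [LinearMap.zero_apply, ← hr, Ideal.Quotient.eq_zero_iff_mem]
      refine h2 (Module.mem_annihilator.2 fun z => ?_)
      obtain ⟨z, rfl⟩ := Submodule.mkQ_surjective _ z
      obtain ⟨a, rfl⟩ := Ideal.Quotient.mk_surjective z
      rw [← map_smul, Submodule.mkQ_apply, Submodule.Quotient.mk_eq_zero]
      refine ⟨a • m, ?_⟩
      rw [map_smul, ← hr, Algebra.smul_def, Algebra.smul_def, mul_comm]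
      rfl
  | exact N₁ N₂ N₃ f g hf hg hfg h₁ h₃ =>
    intro hJ hMN
    have a1 := LinearMap.annihilator_le_of_injective f hf
    have a3 := LinearMap.annihilator_le_of_surjective g hg
    exact (isShortExact_cechMap hf hfg hg L).acyclic_mid
      (h₁ (hJ.trans a1) (hMN.trans a1)) (h₃ (hJ.trans a3) (hMN.trans a3))

/-- If the top Čech cohomology of `M / (x₁, …, xₙ) M` vanishes, then that of `M` is
equal to its own multiple by `(x₁, …, xₙ)`. -/
theorem cech_exists_eq_sum_smul {L : List A} {c n : ℕ} {M : Type u} [AddCommGroup M]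
    [Module A M] [Module.Finite A M]
    (htop : ∀ (N : Type u) [AddCommGroup N] [Module A N] [Module.Finite A N],
      Module.annihilator A M ≤ Module.annihilator A N → (Cech N L).Acyclic (c + 1))
    (x : Fin n → A)
    (hM : ∀ (N : Type u) [AddCommGroup N] [Module A N] [Module.Finite A N],
      Module.annihilator A M ≤ Module.annihilator A N → (∀ i, ∀ z : N, x i • z = 0) →
      (Cech N L).Acyclic c) (z : (Cech M L).H c) :
    ∃ w : Fin n → (Cech M L).H c, z = ∑ i, x i • w i := by
  let h : (Fin n → M) →ₗ[A] M := ∑ i, x i • LinearMap.proj i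
  have hS := isShortExact_cechMap (φ := (LinearMap.ker h).subtype) (ψ := h.rangeRestrict)
    Subtype.val_injective
    (LinearMap.exact_iff.2 (by rw [LinearMap.ker_rangeRestrict, Submodule.range_subtype]))
    h.surjective_rangeRestrict L
  have hS' := isShortExact_cechMap (φ := (LinearMap.range h).subtype)
    (ψ := (LinearMap.range h).mkQ) Subtype.val_injective
    (LinearMap.exact_subtype_mkQ _) (Submodule.mkQ_surjective _) L
  have h1 : (Cech (M ⧸ LinearMap.range h) L).Acyclic c := by
    refine hM _ (LinearMap.annihilator_le_of_surjective _ (Submodule.mkQ_surjective _)) fun i z => ?_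
    obtain ⟨m, rfl⟩ := Submodule.mkQ_surjective _ z
    rw [← map_smul, Submodule.mkQ_apply, Submodule.Quotient.mk_eq_zero]
    refine ⟨Pi.single i m, ?_⟩
    simp [h, LinearMap.sum_apply, Pi.single_apply]
  obtain ⟨z', rfl⟩ := (hS'.exact_mapH c z).1 ((ModComplex.acyclic_iff _).1 h1 _)
  have h2 : Module.annihilator A M ≤ Module.annihilator A (LinearMap.ker h) := by
    refine le_trans ?_ (LinearMap.annihilator_le_of_injective (LinearMap.ker h).subtype
      Subtype.val_injective)
    intro r hr
    rw [Module.mem_annihilator] at *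
    exact fun v => funext fun i => hr (v i)
  obtain ⟨v, rfl⟩ := hS.mapH_surjective (htop _ h2) z'
  have h3 : h = (LinearMap.range h).subtype ∘ₗ h.rangeRestrict := rfl
  refine ⟨fun i => cechH L c (LinearMap.proj i) v, ?_⟩
  rw [← cechH_apply, ← cechH_apply, ← LinearMap.comp_apply, ← cechH_comp, ← h3]
  simp only [h, map_sum, map_smul, LinearMap.sum_apply, LinearMap.smul_apply]

end Vanishing

/-! ### The connecting morphism of left derived functors -/

namespace CategoryTheory

open Limits

universe v₁ v₂ u₁ u₂

section

variable {C : Type u₁} [Category.{v₁} C] [Abelian C]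
  {D : Type u₂} [Category.{v₂} D] [Abelian D]
  {F₁ F₂ F₃ : C ⥤ D} [F₁.Additive] [F₂.Additive] [F₃.Additive]
  (α : F₁ ⟶ F₂) (β : F₂ ⟶ F₃) (w : ∀ X, α.app X ≫ β.app X = 0)
  (h : ∀ (X : C) [Projective X], (ShortComplex.mk (α.app X) (β.app X) (w X)).ShortExact)

namespace ProjectiveResolution

/-- The sequence of complexes obtained by applying a sequence of additive functors to a
projective resolution. -/
abbrev mapShortComplex {X : C} (P : ProjectiveResolution X) :
    ShortComplex (ChainComplex D ℕ) where
  X₁ := (F₁.mapHomologicalComplex _).obj P.complex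
  X₂ := (F₂.mapHomologicalComplex _).obj P.complex
  X₃ := (F₃.mapHomologicalComplex _).obj P.complex
  f := (NatTrans.mapHomologicalComplex α _).app P.complex
  g := (NatTrans.mapHomologicalComplex β _).app P.complex
  zero := by
    ext i
    exact w _

/-- Functoriality of `ProjectiveResolution.mapShortComplex`. -/
abbrev mapShortComplexHom {X Y : C} (P : ProjectiveResolution X)
    (Q : ProjectiveResolution Y) (φ : P.complex ⟶ Q.complex) :
    P.mapShortComplex α β w ⟶ Q.mapShortComplex α β w where
  τ₁ := (F₁.mapHomologicalComplex _).map φ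
  τ₂ := (F₂.mapHomologicalComplex _).map φ
  τ₃ := (F₃.mapHomologicalComplex _).map φ
  comm₁₂ := NatTrans.mapHomologicalComplex_naturality α φ
  comm₂₃ := NatTrans.mapHomologicalComplex_naturality β φ

include h in
theorem shortExact_mapShortComplex {X : C} (P : ProjectiveResolution X) :
    (P.mapShortComplex α β w).ShortExact :=
  HomologicalComplex.shortExact_of_degreewise_shortExact _ fun i => h (P.complex.X i)

/-- The homology of the complex obtained by applying `F` to a projective resolution. -/
abbrev mapHomology {X : C} (P : ProjectiveResolution X) (F : C ⥤ D) [F.Additive] (n : ℕ) : D :=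
  (HomologicalComplex.homologyFunctor D _ n).obj ((F.mapHomologicalComplex _).obj P.complex)

/-- The connecting morphism on homology after applying a sequence of functors to a
projective resolution. -/
def δ {X : C} (P : ProjectiveResolution X) (n : ℕ) :
    P.mapHomology F₃ (n + 1) ⟶ P.mapHomology F₁ n :=
  (P.shortExact_mapShortComplex α β w h).δ (n + 1) n (by simp)

theorem δ_comp {X : C} (P : ProjectiveResolution X) (n : ℕ) :
    P.δ α β w h n ≫ (HomologicalComplex.homologyFunctor D _ n).map
      ((NatTrans.mapHomologicalComplex α _).app P.complex) = 0 :=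
  (P.shortExact_mapShortComplex α β w h).δ_comp (n + 1) n (by simp)

theorem exact_δ {X : C} (P : ProjectiveResolution X) (n : ℕ) :
    (ShortComplex.mk _ _ (P.δ_comp α β w h n)).Exact :=
  (P.shortExact_mapShortComplex α β w h).homology_exact₁ (n + 1) n (by simp)

theorem mono_δ {X : C} (P : ProjectiveResolution X) (n : ℕ)
    (h₂ : IsZero (P.mapHomology F₂ (n + 1))) : Mono (P.δ α β w h n) :=
  (P.shortExact_mapShortComplex α β w h).mono_δ (n + 1) n (by simp) h₂

theorem δ_naturality {X Y : C} (P : ProjectiveResolution X)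
    (Q : ProjectiveResolution Y) (φ : P.complex ⟶ Q.complex) (n : ℕ) :
    P.δ α β w h n ≫ (F₁.mapHomologicalComplex _ ⋙
        HomologicalComplex.homologyFunctor D _ n).map φ =
      (F₃.mapHomologicalComplex _ ⋙
        HomologicalComplex.homologyFunctor D _ (n + 1)).map φ ≫ Q.δ α β w h n :=
  HomologicalComplex.HomologySequence.δ_naturality
    (P.mapShortComplexHom α β w Q φ) (P.shortExact_mapShortComplex α β w h)
    (Q.shortExact_mapShortComplex α β w h) (n + 1) n (by simp)

end ProjectiveResolution

variable [HasProjectiveResolutions C]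

/-- The connecting natural transformation between left derived functors attached to a sequence
of additive functors which is short exact on projective objects. -/
def leftDerivedδ (n : ℕ) : F₃.leftDerived (n + 1) ⟶ F₁.leftDerived n where
  app X := ((projectiveResolution X).isoLeftDerivedObj F₃ (n + 1)).hom ≫
    (projectiveResolution X).δ α β w h n ≫ ((projectiveResolution X).isoLeftDerivedObj F₁ n).inv
  naturality X Y f := by
    have hc : (ProjectiveResolution.lift f (projectiveResolution X)
        (projectiveResolution Y)).f 0 ≫ (projectiveResolution Y).π.f 0 =
        (projectiveResolution X).π.f 0 ≫ f :=
      ProjectiveResolution.lift_commutes_zero _ _ _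
    rw [ProjectiveResolution.isoLeftDerivedObj_hom_naturality_assoc f _ _ _ hc, Category.assoc,
      Category.assoc, ProjectiveResolution.isoLeftDerivedObj_inv_naturality f _ _ _ hc,
      ← reassoc_of% (ProjectiveResolution.δ_naturality α β w h _ _ _ n)]
    rfl

theorem leftDerivedδ_comp (n : ℕ) :
    leftDerivedδ α β w h n ≫ NatTrans.leftDerived α n = 0 := by
  ext X
  rw [NatTrans.comp_app, ProjectiveResolution.leftDerived_app_eq α (projectiveResolution X)]
  simp only [leftDerivedδ, Category.assoc, Iso.inv_hom_id_assoc, zero_app]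
  rw [reassoc_of% ((projectiveResolution X).δ_comp α β w h n), zero_comp, comp_zero]

theorem exact_leftDerivedδ (n : ℕ) (X : C) :
    (ShortComplex.mk ((leftDerivedδ α β w h n).app X) ((NatTrans.leftDerived α n).app X)
      (by rw [← NatTrans.comp_app, leftDerivedδ_comp, zero_app])).Exact := by
  refine (ShortComplex.exact_iff_of_iso ?_).2 ((projectiveResolution X).exact_δ α β w h n)
  refine ShortComplex.isoMk ((projectiveResolution X).isoLeftDerivedObj F₃ (n + 1))
    ((projectiveResolution X).isoLeftDerivedObj F₁ n)
    ((projectiveResolution X).isoLeftDerivedObj F₂ n) ?_ ?_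
  · simp only [leftDerivedδ, Category.assoc, Iso.inv_hom_id, Category.comp_id]
  · simp only [ProjectiveResolution.leftDerived_app_eq α (projectiveResolution X), Category.assoc,
      Iso.inv_hom_id, Category.comp_id]

theorem mono_leftDerivedδ_app (n : ℕ) (X : C) (h₂ : IsZero ((F₂.leftDerived (n + 1)).obj X)) :
    Mono ((leftDerivedδ α β w h n).app X) := by
  have := (projectiveResolution X).mono_δ α β w h n
    (h₂.of_iso ((projectiveResolution X).isoLeftDerivedObj F₂ (n + 1)).symm)
  dsimp [leftDerivedδ]
  infer_instance

end

end CategoryTheory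

/-! ### Dimension shifting for local cohomology -/

section LocalCohomology

open Limits Opposite

variable {A : Type u} [CommRing A]

/-- The contravariant functor `Hom(-, Y)`, as a functor to the opposite category. -/
abbrev homInto (Y : ModuleCat.{u} A) : ModuleCat.{u} A ⥤ (ModuleCat.{u} A)ᵒᵖ :=
  ((linearYoneda A (ModuleCat.{u} A)).obj Y).rightOp

/-- The contravariant dependence of `homInto Y` on `Y`. -/
abbrev homIntoMap {Y Z : ModuleCat.{u} A} (f : Y ⟶ Z) : homInto Z ⟶ homInto Y :=
  NatTrans.rightOp ((linearYoneda A (ModuleCat.{u} A)).map f)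

/-- The functor `Extⁿ(-, Y)`. -/
abbrev extInto (n : ℕ) (Y : ModuleCat.{u} A) : (ModuleCat.{u} A)ᵒᵖ ⥤ ModuleCat.{u} A :=
  ((homInto Y).leftDerived n).leftOp

/-- The natural transformation `Extⁿ(-, Y) ⟶ Extⁿ(-, Z)` induced by `Y ⟶ Z`. -/
abbrev extIntoMap (n : ℕ) {Y Z : ModuleCat.{u} A} (f : Y ⟶ Z) : extInto n Y ⟶ extInto n Z :=
  NatTrans.leftOp (NatTrans.leftDerived (homIntoMap f) n)

variable {S : ShortComplex (ModuleCat.{u} A)} (hS : S.ShortExact)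

theorem homIntoMap_comp_zero (S : ShortComplex (ModuleCat.{u} A)) (X : ModuleCat.{u} A) :
    (homIntoMap S.g).app X ≫ (homIntoMap S.f).app X = 0 := by
  apply Quiver.Hom.unop_inj
  ext (x : X ⟶ S.X₁) : 2
  change (x ≫ S.f) ≫ S.g = 0
  rw [Category.assoc, S.zero, comp_zero]

include hS in
theorem shortExact_homInto (X : ModuleCat.{u} A) [Projective X] :
    (ShortComplex.mk ((homIntoMap S.g).app X) ((homIntoMap S.f).app X)
      (homIntoMap_comp_zero S X)).ShortExact := by
  let T : ShortComplex (ModuleCat.{u} A) :=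
    ShortComplex.mk (((linearYoneda A (ModuleCat.{u} A)).map S.f).app (op X))
      (((linearYoneda A (ModuleCat.{u} A)).map S.g).app (op X))
      (congrArg Quiver.Hom.unop (homIntoMap_comp_zero S X))
  have := hS.mono_f
  have := hS.epi_g
  have hT : T.ShortExact :=
    { exact := by
        rw [ShortComplex.moduleCat_exact_iff]
        intro (x : X ⟶ S.X₂) (hx : x ≫ S.g = 0)
        exact ⟨hS.exact.lift x hx, hS.exact.lift_f x hx⟩
      mono_f := by
        rw [ModuleCat.mono_iff_injective]
        intro (x : X ⟶ S.X₁) (y : X ⟶ S.X₁) (hxy : x ≫ S.f = y ≫ S.f)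
        exact (cancel_mono S.f).1 hxy
      epi_g := by
        rw [ModuleCat.epi_iff_surjective]
        intro (x : X ⟶ S.X₃)
        exact ⟨Projective.factorThru x S.g, Projective.factorThru_comp x S.g⟩ }
  exact hT.op

/-- The connecting homomorphism `Extⁿ(-, C) ⟶ Extⁿ⁺¹(-, M)`. -/
def extIntoδ (n : ℕ) : extInto n S.X₃ ⟶ extInto (n + 1) S.X₁ :=
  NatTrans.leftOp (leftDerivedδ (homIntoMap S.g) (homIntoMap S.f) (homIntoMap_comp_zero S)
    (fun X _ => shortExact_homInto hS X) n)

theorem exact_extIntoδ (n : ℕ) (X : (ModuleCat.{u} A)ᵒᵖ) :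
    Function.Exact ((extIntoMap n S.g).app X) ((extIntoδ hS n).app X) := by
  have h := (exact_leftDerivedδ (homIntoMap S.g) (homIntoMap S.f) (homIntoMap_comp_zero S)
    (fun X _ => shortExact_homInto hS X) n X.unop).unop
  exact (ShortComplex.ShortExact.moduleCat_exact_iff_function_exact _).1 h

theorem isZero_extInto_succ (n : ℕ) (Y : ModuleCat.{u} A) [Injective Y]
    (X : (ModuleCat.{u} A)ᵒᵖ) : IsZero ((extInto (n + 1) Y).obj X) := by
  refine IsZero.of_iso ?_ ((projectiveResolution X.unop).isoExt (R := A) (n + 1) Y)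
  rw [← HomologicalComplex.exactAt_iff_isZero_homology,
    HomologicalComplex.exactAt_iff' _ n (n + 1) (n + 2) (by simp) (by simp)]
  have h := (projectiveResolution X.unop).complex_exactAt_succ n
  rw [HomologicalComplex.exactAt_iff' _ (n + 2) (n + 1) n (by simp) (by simp)] at h
  rw [ShortComplex.moduleCat_exact_iff]
  intro (x : (projectiveResolution X.unop).complex.X (n + 1) ⟶ Y)
    (hx : (projectiveResolution X.unop).complex.d (n + 2) (n + 1) ≫ x = 0)
  exact ⟨h.descToInjective x hx, h.comp_descToInjective x hx⟩

theorem extIntoδ_surjective (n : ℕ) [Injective S.X₂] (X : (ModuleCat.{u} A)ᵒᵖ) :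
    Function.Surjective ((extIntoδ hS n).app X) := by
  have := mono_leftDerivedδ_app (homIntoMap S.g) (homIntoMap S.f) (homIntoMap_comp_zero S)
    (fun X _ => shortExact_homInto hS X) n X.unop (isZero_extInto_succ n S.X₂ X).op
  rw [← ModuleCat.epi_iff_surjective]
  exact unop_epi_of_mono ((leftDerivedδ (homIntoMap S.g) (homIntoMap S.f)
    (homIntoMap_comp_zero S) (fun X _ => shortExact_homInto hS X) n).app X.unop)

instance (Y : ModuleCat.{u} A) : PreservesFiniteColimits (homInto Y) := by
  have : PreservesLimitsOfSize.{0, 0} ((linearYoneda A (ModuleCat.{u} A)).obj Y ⋙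
      forget (ModuleCat.{u} A)) :=
    inferInstanceAs (PreservesLimitsOfSize.{0, 0} (yoneda.obj Y))
  have : PreservesLimitsOfSize.{0, 0} ((linearYoneda A (ModuleCat.{u} A)).obj Y) :=
    preservesLimits_of_reflects_of_preserves _ (forget (ModuleCat.{u} A))
  have : PreservesFiniteLimits ((linearYoneda A (ModuleCat.{u} A)).obj Y) :=
    PreservesLimitsOfSize.preservesFiniteLimits _
  exact preservesFiniteColimits_rightOp _

theorem leftDerived_zero_naturality {C D : Type*} [Category* C] [Category* D] [Abelian C]
    [HasProjectiveResolutions C] [Abelian D] {F G : C ⥤ D} [F.Additive] [G.Additive] (α : F ⟶ G)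
    (X : C) :
    (NatTrans.leftDerived α 0).app X ≫ G.fromLeftDerivedZero.app X =
      F.fromLeftDerivedZero.app X ≫ α.app X := by
  have hι := HomologicalComplex.homologyι_naturality
    ((NatTrans.mapHomologicalComplex α _).app (projectiveResolution X).complex) 0
  have ho : HomologicalComplex.opcyclesMap
      ((NatTrans.mapHomologicalComplex α _).app (projectiveResolution X).complex) 0 ≫
        (projectiveResolution X).fromLeftDerivedZero' G =
      (projectiveResolution X).fromLeftDerivedZero' F ≫ α.app X := by
    rw [← cancel_epi (HomologicalComplex.pOpcycles _ _),
      HomologicalComplex.p_opcyclesMap_assoc, ProjectiveResolution.pOpcycles_comp_fromLeftDerivedZero',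
      ProjectiveResolution.pOpcycles_comp_fromLeftDerivedZero'_assoc]
    exact (α.naturality _).symm
  rw [(projectiveResolution X).fromLeftDerivedZero_eq, (projectiveResolution X).fromLeftDerivedZero_eq,
    ProjectiveResolution.leftDerived_app_eq α (projectiveResolution X) 0]
  simp only [Category.assoc, Iso.inv_hom_id_assoc]
  congr 1
  refine (Category.assoc _ _ _).symm.trans ((congr($hι ≫ _)).trans ?_)
  refine (Category.assoc _ _ _).trans ((congr(_ ≫ $ho)).trans ?_)
  exact (Category.assoc _ _ _).symm

/-- The natural isomorphism `Ext⁰(-, Y) ⟶ Hom(-, Y)`. -/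
def extIntoZero (Y : ModuleCat.{u} A) :
    extInto 0 Y ⟶ (linearYoneda A (ModuleCat.{u} A)).obj Y :=
  NatTrans.leftOp (homInto Y).leftDerivedZeroIsoSelf.inv

instance (Y : ModuleCat.{u} A) (X : (ModuleCat.{u} A)ᵒᵖ) : IsIso ((extIntoZero Y).app X) :=
  inferInstanceAs (IsIso ((homInto Y).leftDerivedZeroIsoSelf.inv.app X.unop).unop)

theorem extIntoZero_bijective (Y : ModuleCat.{u} A) (X : (ModuleCat.{u} A)ᵒᵖ) :
    Function.Bijective ((extIntoZero Y).app X) :=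
  ConcreteCategory.bijective_of_isIso _

theorem extIntoZero_naturality {Y Z : ModuleCat.{u} A} (f : Y ⟶ Z) (X : (ModuleCat.{u} A)ᵒᵖ) :
    (extIntoMap 0 f).app X ≫ (extIntoZero Z).app X =
      (extIntoZero Y).app X ≫ ((linearYoneda A (ModuleCat.{u} A)).map f).app X := by
  have h := leftDerived_zero_naturality (homIntoMap f) X.unop
  have h' : (homInto Z).leftDerivedZeroIsoSelf.inv.app X.unop ≫
      (NatTrans.leftDerived (homIntoMap f) 0).app X.unop =
      (homIntoMap f).app X.unop ≫ (homInto Y).leftDerivedZeroIsoSelf.inv.app X.unop := by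
    rw [← cancel_mono ((homInto Y).fromLeftDerivedZero.app X.unop), Category.assoc, h]
    simp
  exact congrArg Quiver.Hom.unop h'

open localCohomology

variable (J : Ideal A)

/-- The direct system computing the local cohomology of `Y`. -/
abbrev lcDiagram (n : ℕ) (Y : ModuleCat.{u} A) : (ℕᵒᵖ)ᵒᵖ ⥤ ModuleCat.{u} A :=
  (ringModIdeals (idealPowersDiagram J)).op ⋙ extInto n Y

/-- The local cohomology of a single module, as a direct limit of `Ext` modules. -/
def lcObj (n : ℕ) (Y : ModuleCat.{u} A) : ModuleCat.{u} A := colimit (lcDiagram J n Y)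

/-- Functoriality of `lcObj`. -/
def lcMap (n : ℕ) {Y Z : ModuleCat.{u} A} (f : Y ⟶ Z) : lcObj J n Y ⟶ lcObj J n Z :=
  colimMap (Functor.whiskerLeft _ (extIntoMap n f))

/-- The connecting homomorphism for `lcObj`. -/
def lcδ (n : ℕ) : lcObj J n S.X₃ ⟶ lcObj J (n + 1) S.X₁ :=
  colimMap (Functor.whiskerLeft _ (extIntoδ hS n))

/-- `lcObj` computes local cohomology. -/
def lcObjIso (n : ℕ) (Y : ModuleCat.{u} A) : (localCohomology J n).obj Y ≅ lcObj J n Y :=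
  colimitObjIsoColimitCompEvaluation (diagram (idealPowersDiagram J) n) Y

instance : PreservesFilteredColimitsOfSize.{0, 0} (forget (ModuleCat.{u} A)) :=
  preservesSmallestFilteredColimits_of_preservesFilteredColimits.{u, u} _

theorem lcObj_rep (n : ℕ) (Y : ModuleCat.{u} A) (z : lcObj J n Y) :
    ∃ j x, colimit.ι (lcDiagram J n Y) j x = z :=
  Concrete.colimit_exists_rep _ z

theorem lcMap_ι (n : ℕ) {Y Z : ModuleCat.{u} A} (f : Y ⟶ Z) (j x) :
    lcMap J n f (colimit.ι (lcDiagram J n Y) j x) =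
      colimit.ι (lcDiagram J n Z) j ((extIntoMap n f).app _ x) := 
  congr($(ι_colimMap (Functor.whiskerLeft _ (extIntoMap n f)) j) x)

theorem lcδ_ι (n : ℕ) (j x) :
    lcδ hS J n (colimit.ι (lcDiagram J n S.X₃) j x) =
      colimit.ι (lcDiagram J (n + 1) S.X₁) j ((extIntoδ hS n).app _ x) := 
  congr($(ι_colimMap (Functor.whiskerLeft _ (extIntoδ hS n)) j) x)

theorem exact_lcδ (n : ℕ) : Function.Exact (lcMap J n S.g) (lcδ hS J n) := by
  intro z
  obtain ⟨j, x, rfl⟩ := lcObj_rep J n _ z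
  constructor
  · intro h
    rw [lcδ_ι] at h
    obtain ⟨j', f, hf⟩ := Concrete.colimit_rep_eq_zero A (lcDiagram J (n + 1) S.X₁) j _ h
    have hx : (extIntoδ hS n).app _ ((lcDiagram J n S.X₃).map f x) = 0 :=
      (congr($((extIntoδ hS n).naturality ((ringModIdeals (idealPowersDiagram J)).op.map f))
        x)).trans hf
    obtain ⟨y, hy⟩ := (exact_extIntoδ hS n _ _).1 hx
    refine ⟨colimit.ι (lcDiagram J n S.X₂) j' y, ?_⟩
    rw [lcMap_ι]
    exact (congrArg _ hy).trans congr($(colimit.w (lcDiagram J n S.X₃) f) x)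
  · rintro ⟨y, hy⟩
    obtain ⟨i, y, rfl⟩ := lcObj_rep J n _ y
    rw [← hy, lcMap_ι, lcδ_ι]
    exact (congrArg _ ((exact_extIntoδ hS n _).apply_apply_eq_zero y)).trans (map_zero _)

theorem lcδ_surjective (n : ℕ) [Injective S.X₂] : Function.Surjective (lcδ hS J n) := by
  intro z
  obtain ⟨j, x, rfl⟩ := lcObj_rep J _ _ z
  obtain ⟨y, rfl⟩ := extIntoδ_surjective hS n _ x
  exact ⟨_, lcδ_ι hS J n j y⟩

theorem lcObj_subsingleton (n : ℕ) (Y : ModuleCat.{u} A) [Injective Y] :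
    Subsingleton (lcObj J (n + 1) Y) := by
  refine subsingleton_of_forall_eq 0 fun z => ?_
  obtain ⟨j, x, rfl⟩ := lcObj_rep J _ _ z
  have : Subsingleton ((lcDiagram J (n + 1) Y).obj j) :=
    ModuleCat.subsingleton_of_isZero (isZero_extInto_succ n Y ((ringModIdeals (idealPowersDiagram J)).op.obj j))
  exact (congrArg _ (Subsingleton.elim x 0)).trans (map_zero _)

/-- Evaluation at `1` on homomorphisms out of `A ⧸ Jⁿ`. -/
def evalOne (Y : ModuleCat.{u} A) (j : (ℕᵒᵖ)ᵒᵖ) :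
    ((linearYoneda A (ModuleCat.{u} A)).obj Y).obj
      ((ringModIdeals (idealPowersDiagram J)).op.obj j) ⟶ Y :=
  ModuleCat.ofHom
    { toFun φ := ModuleCat.Hom.hom φ (Ideal.Quotient.mk _ 1)
      map_add' _ _ := rfl
      map_smul' _ _ := rfl }

/-- The cocone defining `lcZero`. -/
def lcZeroCocone (Y : ModuleCat.{u} A) : Cocone (lcDiagram J 0 Y) where
  pt := Y
  ι :=
    { app j := (extIntoZero Y).app _ ≫ evalOne J Y j
      naturality i j f := by
        ext x
        exact congr(evalOne J Y j $(congr($((extIntoZero Y).naturality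
          ((ringModIdeals (idealPowersDiagram J)).op.map f)) x))) }

/-- The map from degree zero local cohomology to the module. -/
def lcZero (Y : ModuleCat.{u} A) : lcObj J 0 Y ⟶ Y :=
  colimit.desc (lcDiagram J 0 Y) (lcZeroCocone J Y)

theorem lcZero_ι (Y : ModuleCat.{u} A) (j x) :
    lcZero J Y (colimit.ι (lcDiagram J 0 Y) j x) = evalOne J Y j ((extIntoZero Y).app _ x) :=
  congr($(colimit.ι_desc (lcZeroCocone J Y) j) x)

theorem lcZero_naturality {Y Z : ModuleCat.{u} A} (f : Y ⟶ Z) (z : lcObj J 0 Y) :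
    lcZero J Z (lcMap J 0 f z) = f (lcZero J Y z) := by
  obtain ⟨j, x, rfl⟩ := lcObj_rep J _ _ z
  rw [lcMap_ι, lcZero_ι, lcZero_ι]
  exact congr(evalOne J Z j ($(extIntoZero_naturality f
    ((ringModIdeals (idealPowersDiagram J)).op.obj j)) x))

theorem lcZero_injective (Y : ModuleCat.{u} A) : Function.Injective (lcZero J Y) := by
  rw [injective_iff_map_eq_zero]
  intro z hz
  obtain ⟨j, x, rfl⟩ := lcObj_rep J _ _ z
  rw [lcZero_ι] at hz
  have : (extIntoZero Y).app _ x = 0 := by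
    apply ModuleCat.hom_ext
    apply LinearMap.ext
    intro q
    obtain ⟨a, rfl⟩ := Ideal.Quotient.mk_surjective q
    have h : Ideal.Quotient.mk ((idealPowersDiagram J).obj j.unop) a =
        a • Ideal.Quotient.mk ((idealPowersDiagram J).obj j.unop) 1 := by
      rw [← Ideal.Quotient.mk_eq_mk, ← Ideal.Quotient.mk_eq_mk, ← Submodule.Quotient.mk_smul,
        smul_eq_mul, mul_one]
    exact ((congrArg _ h).trans (map_smul (ModuleCat.Hom.hom ((extIntoZero Y).app _ x)) a _)).trans
      ((congrArg (a • ·) hz).trans (smul_zero a))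
  rw [(extIntoZero_bijective Y _).1 (this.trans (map_zero _).symm)]
  exact map_zero _

theorem mem_range_lcZero (Y : ModuleCat.{u} A) (y : Y) :
    y ∈ Set.range (lcZero J Y) ↔ ∃ n, ∀ a ∈ J ^ n, a • y = 0 := by
  constructor
  · rintro ⟨z, rfl⟩
    obtain ⟨j, x, rfl⟩ := lcObj_rep J _ _ z
    refine ⟨j.unop.unop, fun a ha => ?_⟩
    rw [lcZero_ι]
    refine (map_smul (ModuleCat.Hom.hom ((extIntoZero Y).app _ x)) a _).symm.trans ?_
    refine (congrArg _ ?_).trans (map_zero (ModuleCat.Hom.hom ((extIntoZero Y).app _ x)))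
    change a • Submodule.Quotient.mk (p := J ^ j.unop.unop) (1 : A) = 0
    rw [← Submodule.Quotient.mk_smul, smul_eq_mul, mul_one, Submodule.Quotient.mk_eq_zero]
    exact ha
  · rintro ⟨n, hn⟩
    let φ : (A ⧸ J ^ n) →ₗ[A] Y :=
      Submodule.liftQ (J ^ n) (LinearMap.toSpanSingleton A Y y) fun a ha => hn a ha
    obtain ⟨x, hx⟩ := (extIntoZero_bijective Y
      ((ringModIdeals (idealPowersDiagram J)).op.obj (op (op n)))).2 (ModuleCat.ofHom φ)
    refine ⟨colimit.ι (lcDiagram J 0 Y) (op (op n)) x, ?_⟩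
    rw [lcZero_ι]
    refine (congrArg (evalOne J Y (op (op n))) hx).trans ?_
    change φ (Submodule.Quotient.mk 1) = y
    exact (Submodule.liftQ_apply _ _ _).trans (one_smul A y)

end LocalCohomology

/-! ### Local cohomology is Čech cohomology -/

section Comparison

variable {A : Type u} [CommRing A]

theorem LinearMap.nonempty_equiv_of_exact {X Y Z X' Y' Z' : Type u}
    [AddCommGroup X] [AddCommGroup Y] [AddCommGroup Z] [AddCommGroup X'] [AddCommGroup Y']
    [AddCommGroup Z'] [Module A X] [Module A Y] [Module A Z] [Module A X'] [Module A Y']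
    [Module A Z'] {g : X →ₗ[A] Y} {δ : Y →ₗ[A] Z} {g' : X' →ₗ[A] Y'} {δ' : Y' →ₗ[A] Z'}
    (h : Function.Exact g δ) (hδ : Function.Surjective δ) (h' : Function.Exact g' δ')
    (hδ' : Function.Surjective δ') (eX : X ≃ₗ[A] X') (eY : Y ≃ₗ[A] Y')
    (comm : ∀ x, eY (g x) = g' (eX x)) : Nonempty (Z ≃ₗ[A] Z') := by
  refine ⟨(LinearMap.quotKerEquivOfSurjective δ hδ).symm.trans
    ((Submodule.Quotient.equiv _ _ eY ?_).trans (LinearMap.quotKerEquivOfSurjective δ' hδ'))⟩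
  rw [h.linearMap_ker_eq, h'.linearMap_ker_eq]
  ext y
  constructor
  · rintro ⟨_, ⟨x, rfl⟩, rfl⟩
    exact ⟨eX x, (comm x).symm⟩
  · rintro ⟨x, rfl⟩
    exact ⟨_, ⟨eX.symm x, rfl⟩, (comm _).trans (by rw [eX.apply_symm_apply])⟩

variable [IsNoetherianRing A] (L : List A)

theorem exists_span_pow_smul_eq_zero_iff {M : Type u} [AddCommGroup M] [Module A M] (y : M) :
    (∃ n, ∀ a ∈ (Ideal.span {f : A | f ∈ L} : Ideal A) ^ n, a • y = 0) ↔ ∀ f ∈ L, ∃ n : ℕ, f ^ n • y = 0 := by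
  constructor
  · rintro ⟨n, hn⟩ f hf
    exact ⟨n, hn _ (Ideal.pow_mem_pow (Ideal.subset_span (s := {f : A | f ∈ L}) hf) n)⟩
  · intro h
    obtain ⟨n, hn⟩ := Ideal.exists_pow_le_of_le_radical_of_fg
      (I := Ideal.span {f : A | f ∈ L}) (J := Ideal.torsionOf A M y)
      (Ideal.span_le.2 fun f hf => h f hf) (IsNoetherian.noetherian _)
    exact ⟨n, fun a ha => hn ha⟩

theorem cechAug_lcZero_mem (M : ModuleCat.{u} A) (z : lcObj (Ideal.span {f : A | f ∈ L}) 0 M) :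
    cechAug L (lcZero _ M z) ∈ (Cech M L).cocycles 0 :=
  cechAug_mem_cocycles.2 <| (exists_span_pow_smul_eq_zero_iff L _).1 <|
    (mem_range_lcZero _ M _).1 ⟨z, rfl⟩

/-- Local cohomology agrees with Čech cohomology in degree zero. -/
def lcObjZeroEquiv (M : ModuleCat.{u} A) :
    lcObj (Ideal.span {f : A | f ∈ L}) 0 M ≃ₗ[A] (Cech M L).H 0 :=
  LinearEquiv.ofBijective
    ((Cech M L).cls 0 ∘ₗ ((cechAug L).toLinearMap ∘ₗ (lcZero _ M).hom).codRestrict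
      ((Cech M L).cocycles 0) (cechAug_lcZero_mem L M)) <| by
    constructor
    · rw [injective_iff_map_eq_zero]
      intro z hz
      have h := (Cech M L).cls_eq_zero.1 hz
      rw [coboundaries_zero, Submodule.mem_bot] at h
      exact lcZero_injective _ M (((cechAug L).map_eq_zero_iff.1 h).trans (map_zero _).symm)
    · intro z
      obtain ⟨x, rfl⟩ := ModComplex.cls_surjective _ 0 z
      obtain ⟨y, hy⟩ := (cechAug L).surjective x.1
      obtain ⟨w, hw⟩ := (mem_range_lcZero (Ideal.span {f : A | f ∈ L}) M y).2
        ((exists_span_pow_smul_eq_zero_iff L y).2 (cechAug_mem_cocycles.1 (hy ▸ x.2)))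
      refine ⟨w, congrArg ((Cech M L).cls 0) (Subtype.ext ?_)⟩
      exact (congrArg (cechAug L) hw).trans hy

theorem lcObjZeroEquiv_naturality {M N : ModuleCat.{u} A} (f : M ⟶ N)
    (z : lcObj (Ideal.span {f : A | f ∈ L}) 0 M) :
    lcObjZeroEquiv L N ((lcMap _ 0 f).hom z) = (cechMap f.hom L).mapH 0 (lcObjZeroEquiv L M z) := by
  refine congrArg ((Cech N L).cls 0) (Subtype.ext ?_)
  refine (congrArg (cechAug L) (lcZero_naturality _ f z)).trans ?_
  exact (cechAug_natural f.hom _ L).symm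

theorem nonempty_lcObj_equiv : ∀ (k : ℕ) (M : ModuleCat.{u} A),
    Nonempty (lcObj (Ideal.span {f : A | f ∈ L}) k M ≃ₗ[A] (Cech M L).H k)
  | 0, M => ⟨lcObjZeroEquiv L M⟩
  | k + 1, M => by
    obtain ⟨⟨G, hG, ι, hι⟩⟩ := EnoughInjectives.presentation M
    rw [ModuleCat.mono_iff_injective] at hι
    let S : ShortComplex (ModuleCat.{u} A) := ShortComplex.mk ι
      (ModuleCat.ofHom (LinearMap.range ι.hom).mkQ) (by
        ext x
        exact (Submodule.Quotient.mk_eq_zero _).2 ⟨x, rfl⟩)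
    have hex : Function.Exact S.f.hom S.g.hom := LinearMap.exact_map_mkQ_range ι.hom
    have hsurj : Function.Surjective S.g.hom := Submodule.mkQ_surjective _
    have hS : S.ShortExact :=
      { exact := (ShortComplex.ShortExact.moduleCat_exact_iff_function_exact S).2 hex
        mono_f := (ModuleCat.mono_iff_injective _).2 hι
        epi_g := (ModuleCat.epi_iff_surjective _).2 hsurj }
    have hb : Module.Baer A G :=
      Module.Baer.iff_injective.2 (Module.injective_module_of_injective_object A G)
    have hE := (cech_of_injective hb L).1
    have hC := isShortExact_cechMap (φ := S.f.hom) (ψ := S.g.hom) hι hex hsurj L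
    obtain ⟨δ, h₁, h₂⟩ := hC.exists_delta k
    have hδ : Function.Surjective δ := fun z =>
      (h₂ z).1 ((Cech G L).acyclic_iff.1 (hE k) _)
    have : Injective S.X₂ := hG
    have h₃ := exact_lcδ hS (Ideal.span {f : A | f ∈ L}) k
    have h₄ := lcδ_surjective hS (Ideal.span {f : A | f ∈ L}) k
    match k with
    | 0 =>
      exact LinearMap.nonempty_equiv_of_exact h₃ h₄ h₁ hδ (lcObjZeroEquiv L S.X₂)
        (lcObjZeroEquiv L S.X₃) fun z => lcObjZeroEquiv_naturality L S.g z
    | k + 1 =>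
      obtain ⟨e⟩ := nonempty_lcObj_equiv (k + 1) S.X₃
      have h₅ := lcObj_subsingleton (Ideal.span {f : A | f ∈ L}) k G
      have h₆ : Subsingleton ((Cech G L).H (k + 1)) :=
        subsingleton_of_forall_eq 0 ((Cech G L).acyclic_iff.1 (hE k))
      exact LinearMap.nonempty_equiv_of_exact h₃ h₄ h₁ hδ 0 e fun z => by
        rw [show z = 0 from Subsingleton.elim (α := lcObj _ (k + 1) G) _ _, map_zero]
        exact (map_zero e).trans (map_zero ((cechMap S.g.hom L).mapH (k + 1))).symm

/-- Local cohomology with respect to a finitely generated ideal is Čech cohomology. -/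
theorem nonempty_localCohomology_equiv (k : ℕ) (M : Type u) [AddCommGroup M] [Module A M] :
    Nonempty ((localCohomology (Ideal.span {f : A | f ∈ L}) k).obj (ModuleCat.of A M) ≃ₗ[A]
      (Cech M L).H k) := by
  obtain ⟨e⟩ := nonempty_lcObj_equiv L k (ModuleCat.of A M)
  exact ⟨(lcObjIso (Ideal.span {f : A | f ∈ L}) k (ModuleCat.of A M)).toLinearEquiv.trans e⟩

end Comparison

/-! ### Bigraded modules -/

section Bigraded

variable {K R 𝒜} {M N : Type u} [AddCommGroup M] [Module R M] [AddCommGroup N] [Module R N]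

namespace Bigrading

theorem isInternal_of_iSup_eq_top {G : ℤ × ℤ → AddSubgroup M} (hG : iSup G = ⊤)
    (ind : ∀ (s : Finset (ℤ × ℤ)) (d : ℤ × ℤ → M), (∀ b, d b ∈ G b) → ∑ b ∈ s, d b = 0 →
      ∀ b ∈ s, d b = 0) : DirectSum.IsInternal G := by
  classical
  constructor
  · rw [injective_iff_map_eq_zero]
    intro x hx
    rw [DirectSum.coeAddMonoidHom_eq_dfinsuppSum, DFinsupp.sum] at hx
    refine DFinsupp.ext fun b => Subtype.ext ?_
    by_cases hb : b ∈ DFinsupp.support x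
    · exact ind _ (fun b => x b) (fun b => (x b).2) hx b hb
    · rw [DFinsupp.notMem_support_iff.1 hb]
      rfl
  · rw [← AddMonoidHom.range_eq_top, eq_top_iff, ← hG, iSup_le_iff]
    intro b x hx
    exact ⟨DirectSum.of (fun b => G b) b ⟨x, hx⟩, DirectSum.coeAddMonoidHom_of _ _ _⟩

/-- Constructor for `Bigrading`, with directness expressed by finite sums. -/
def ofISup [GradedAlgebra 𝒜] (G : ℤ × ℤ → AddSubgroup M) (hG : iSup G = ⊤)
    (ind : ∀ (s : Finset (ℤ × ℤ)) (d : ℤ × ℤ → M), (∀ b, d b ∈ G b) → ∑ b ∈ s, d b = 0 →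
      ∀ b ∈ s, d b = 0)
    (compat : ∀ (a : ℕ × ℕ) (b : ℤ × ℤ) (r : R) (x : M), r ∈ 𝒜 a → x ∈ G b →
      r • x ∈ G (((a.1 : ℤ), (a.2 : ℤ)) + b)) : Bigrading K R 𝒜 M where
  grading := G
  ksmul_mem c b x hx := by
    have h := compat 0 b _ x (SetLike.algebraMap_mem_graded 𝒜 c) hx
    rwa [show ((((0 : ℕ × ℕ).1 : ℤ), ((0 : ℕ × ℕ).2 : ℤ)) + b) = b from zero_add b] at h
  internal := isInternal_of_iSup_eq_top hG ind
  compat := compat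

section Projections

variable (bg : Bigrading K R 𝒜 M)

/-- The decomposition of a bigraded module. -/
def decomp : DirectSum (ℤ × ℤ) (fun b => bg.grading b) ≃+ M :=
  AddEquiv.ofBijective _ bg.internal

/-- The projection onto a homogeneous component. -/
def proj (b : ℤ × ℤ) : M →+ M :=
  (bg.grading b).subtype.comp ((DFinsupp.evalAddMonoidHom b).comp bg.decomp.symm.toAddMonoidHom)

theorem proj_apply (b : ℤ × ℤ) (x : M) : bg.proj b x = bg.decomp.symm x b := rfl

theorem proj_mem (b : ℤ × ℤ) (x : M) : bg.proj b x ∈ bg.grading b := (bg.decomp.symm x b).2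

theorem decomp_symm_of_mem {b : ℤ × ℤ} {x : M} (hx : x ∈ bg.grading b) :
    bg.decomp.symm x = DirectSum.of (fun b => bg.grading b) b ⟨x, hx⟩ := by
  rw [AddEquiv.symm_apply_eq]
  exact (DirectSum.coeAddMonoidHom_of bg.grading b ⟨x, hx⟩).symm

theorem proj_of_mem {b : ℤ × ℤ} {x : M} (hx : x ∈ bg.grading b) : bg.proj b x = x := by
  rw [proj_apply, bg.decomp_symm_of_mem hx, DirectSum.of_eq_same]

theorem proj_of_mem_ne {b c : ℤ × ℤ} {x : M} (hx : x ∈ bg.grading b) (h : b ≠ c) :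
    bg.proj c x = 0 := by
  rw [proj_apply, bg.decomp_symm_of_mem hx, DirectSum.of_eq_of_ne _ _ _ h.symm]
  rfl

theorem exists_sum_proj (x : M) : ∃ s : Finset (ℤ × ℤ), x = ∑ b ∈ s, bg.proj b x ∧
    ∀ b ∉ s, bg.proj b x = 0 := by
  classical
  refine ⟨DFinsupp.support (bg.decomp.symm x), ?_, fun b hb => ?_⟩
  · conv_lhs => rw [← bg.decomp.apply_symm_apply x]
    exact DirectSum.coeAddMonoidHom_eq_dfinsuppSum bg.grading _
  · rw [proj_apply, DFinsupp.notMem_support_iff.1 hb]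
    rfl

theorem iSup_grading : iSup bg.grading = ⊤ := by
  rw [eq_top_iff]
  intro x _
  obtain ⟨s, hs, -⟩ := bg.exists_sum_proj x
  rw [hs]
  exact sum_mem fun b _ => AddSubgroup.mem_iSup_of_mem b (bg.proj_mem b x)

theorem induction_on {p : M → Prop} (x : M) (hom : ∀ b, ∀ x ∈ bg.grading b, p x)
    (zero : p 0) (add : ∀ x y, p x → p y → p (x + y)) : p x :=
  AddSubgroup.iSup_induction bg.grading (C := p) (by rw [iSup_grading]; trivial) hom zero add

theorem proj_sum {s : Finset (ℤ × ℤ)} {d : ℤ × ℤ → M} (hd : ∀ b, d b ∈ bg.grading b)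
    {b : ℤ × ℤ} (hb : b ∈ s) : bg.proj b (∑ c ∈ s, d c) = d b := by
  rw [map_sum, Finset.sum_eq_single_of_mem b hb fun c _ hc => bg.proj_of_mem_ne (hd c) hc,
    bg.proj_of_mem (hd b)]

theorem proj_map (bg' : Bigrading K R 𝒜 N) (φ : M →+ N) (a : ℤ × ℤ)
    (hφ : ∀ b, ∀ x ∈ bg.grading b, φ x ∈ bg'.grading (a + b)) (b : ℤ × ℤ) (x : M) :
    bg'.proj (a + b) (φ x) = φ (bg.proj b x) := by
  induction x using bg.induction_on with
  | hom c x hx =>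
    by_cases h : c = b
    · subst h
      rw [bg.proj_of_mem hx, bg'.proj_of_mem (hφ c x hx)]
    · rw [bg.proj_of_mem_ne hx h, map_zero,
        bg'.proj_of_mem_ne (hφ c x hx) fun h' => h (add_left_cancel h')]
  | zero => simp
  | add x y hx hy => simp only [map_add, hx, hy]

theorem proj_map_zero (bg' : Bigrading K R 𝒜 N) (φ : M →+ N)
    (hφ : ∀ b, ∀ x ∈ bg.grading b, φ x ∈ bg'.grading b) (b : ℤ × ℤ) (x : M) :
    bg'.proj b (φ x) = φ (bg.proj b x) := by
  have h := bg.proj_map bg' φ 0 (fun b x hx => by rw [zero_add]; exact hφ b x hx) b x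
  rwa [zero_add] at h

theorem proj_smul {a : ℕ × ℕ} {r : R} (hr : r ∈ 𝒜 a) (b : ℤ × ℤ) (x : M) :
    bg.proj (((a.1 : ℤ), (a.2 : ℤ)) + b) (r • x) = r • bg.proj b x :=
  bg.proj_map bg (DistribSMul.toAddMonoidHom M r) _ (fun b x hx => bg.compat a b r x hr hx) b x

theorem eq_zero_of_proj_eq_zero {x : M} (h : ∀ b, bg.proj b x = 0) : x = 0 := by
  obtain ⟨s, hs, -⟩ := bg.exists_sum_proj x
  rw [hs]
  exact Finset.sum_eq_zero fun b _ => h b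

end Projections

variable [GradedAlgebra 𝒜]

/-- The bigrading of a trivial module. -/
def ofSubsingleton (M : Type u) [AddCommGroup M] [Module R M] [Subsingleton M] :
    Bigrading K R 𝒜 M :=
  ofISup (fun _ => ⊥) (Subsingleton.elim _ _) (fun _ _ _ _ _ _ => Subsingleton.elim _ _)
    fun _ _ _ _ _ _ => Subsingleton.elim _ _

/-- Transport of a bigrading along an isomorphism. -/
def transport (bg : Bigrading K R 𝒜 M) (e : M ≃ₗ[R] N) : Bigrading K R 𝒜 N :=
  ofISup (fun b => (bg.grading b).comap e.symm.toAddEquiv.toAddMonoidHom)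
    (by
      rw [eq_top_iff]
      rintro y -
      obtain ⟨x, rfl⟩ := e.surjective y
      induction x using bg.induction_on with
      | hom b x hx =>
        refine AddSubgroup.mem_iSup_of_mem b ?_
        change e.symm (e x) ∈ bg.grading b
        rwa [e.symm_apply_apply]
      | zero => rw [map_zero]; exact zero_mem _
      | add x y hx hy => rw [map_add]; exact add_mem hx hy)
    (fun s d hd h b hb => by
      have := bg.proj_sum (s := s) (d := fun b => e.symm (d b)) hd hb
      rw [← map_sum, h, map_zero, map_zero] at this
      exact e.symm.map_eq_zero_iff.1 this.symm)
    fun a b r x hr hx => by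
      change e.symm (r • x) ∈ bg.grading _
      rw [map_smul]
      exact bg.compat a b r _ hr hx

theorem transport_eq_bot (bg : Bigrading K R 𝒜 M) (e : M ≃ₗ[R] N) (b : ℤ × ℤ) :
    (bg.transport e).grading b = ⊥ ↔ bg.grading b = ⊥ := by
  rw [AddSubgroup.eq_bot_iff_forall, AddSubgroup.eq_bot_iff_forall]
  constructor
  · intro h x hx
    refine e.map_eq_zero_iff.1 (h (e x) ?_)
    change e.symm (e x) ∈ bg.grading b
    rwa [e.symm_apply_apply]
  · intro h x hx
    exact e.symm.map_eq_zero_iff.1 (h _ hx)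

theorem _root_.IsTame.transport {bg : Bigrading K R 𝒜 M} (h : IsTame K R 𝒜 bg) (e : M ≃ₗ[R] N) :
    IsTame K R 𝒜 (bg.transport e) := by
  simpa only [IsTame, ne_eq, transport_eq_bot] using h

/-- The bigrading of a product. -/
def prod (bg : Bigrading K R 𝒜 M) (bg' : Bigrading K R 𝒜 N) : Bigrading K R 𝒜 (M × N) :=
  ofISup (fun b => (bg.grading b).prod (bg'.grading b))
    (by
      rw [eq_top_iff]
      rintro ⟨x, y⟩ -
      rw [← Prod.fst_add_snd (x, y)]
      refine add_mem ?_ ?_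
      · induction x using bg.induction_on with
        | hom b x hx => exact AddSubgroup.mem_iSup_of_mem b ⟨hx, zero_mem _⟩
        | zero => exact zero_mem _
        | add x x' hx hx' =>
          rw [show ((x + x', 0) : M × N) = (x, 0) + (x', 0) by simp]
          exact add_mem hx hx'
      · induction y using bg'.induction_on with
        | hom b y hy => exact AddSubgroup.mem_iSup_of_mem b ⟨zero_mem _, hy⟩
        | zero => exact zero_mem _
        | add y y' hy hy' =>
          rw [show ((0, y + y') : M × N) = (0, y) + (0, y') by simp]
          exact add_mem hy hy')
    (fun s d hd h b hb => by
      refine Prod.ext ?_ ?_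
      · rw [← bg.proj_sum (d := fun b => (d b).1) (fun b => (hd b).1) hb, ← Prod.fst_sum, h]
        exact map_zero _
      · rw [← bg'.proj_sum (d := fun b => (d b).2) (fun b => (hd b).2) hb, ← Prod.snd_sum, h]
        exact map_zero _)
    fun a b r x hr hx => ⟨bg.compat a b r _ hr hx.1, bg'.compat a b r _ hr hx.2⟩

theorem pow_smul_mem (bg : Bigrading K R 𝒜 M) {f : R} {a : ℕ × ℕ} (hf : f ∈ 𝒜 a) (n : ℕ)
    {b : ℤ × ℤ} {x : M} (hx : x ∈ bg.grading b) :
    f ^ n • x ∈ bg.grading (b + n • ((a.1 : ℤ), (a.2 : ℤ))) := by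
  have h := bg.compat _ b _ x (SetLike.pow_mem_graded n hf) hx
  rwa [add_comm, show (((n • a).1 : ℤ), ((n • a).2 : ℤ)) = n • ((a.1 : ℤ), (a.2 : ℤ)) by simp] at h

theorem proj_pow_smul (bg : Bigrading K R 𝒜 M) {f : R} {a : ℕ × ℕ} (hf : f ∈ 𝒜 a) (n : ℕ)
    (b : ℤ × ℤ) (x : M) :
    bg.proj (b + n • ((a.1 : ℤ), (a.2 : ℤ))) (f ^ n • x) = f ^ n • bg.proj b x := by
  have h := bg.proj_smul (SetLike.pow_mem_graded n hf) b x
  rwa [add_comm, show (((n • a).1 : ℤ), ((n • a).2 : ℤ)) = n • ((a.1 : ℤ), (a.2 : ℤ)) by simp] at h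

/-- The homogeneous components of the localization at a homogeneous element. -/
def awayGrading (bg : Bigrading K R 𝒜 M) {f : R} {a : ℕ × ℕ} (hf : f ∈ 𝒜 a) (b : ℤ × ℤ) :
    AddSubgroup (ModAway f M) where
  carrier := {z | ∃ (n : ℕ), ∃ x ∈ bg.grading (b + n • ((a.1 : ℤ), (a.2 : ℤ))),
    f ^ n • z = toAway f M x}
  zero_mem' := ⟨0, 0, zero_mem _, by simp⟩
  neg_mem' := by
    rintro z ⟨n, x, hx, h⟩
    exact ⟨n, -x, neg_mem hx, by rw [smul_neg, h, map_neg]⟩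
  add_mem' := by
    rintro z w ⟨n, x, hx, h⟩ ⟨m, y, hy, h'⟩
    refine ⟨n + m, f ^ m • x + f ^ n • y, add_mem ?_ ?_, ?_⟩
    · rw [add_smul, ← add_assoc]
      exact bg.pow_smul_mem hf m hx
    · rw [add_comm n, add_smul, ← add_assoc]
      exact bg.pow_smul_mem hf n hy
    · rw [map_add, map_smul, map_smul, ← h, ← h', smul_smul, smul_smul, ← pow_add, ← pow_add,
        add_comm m, smul_add]

theorem toAway_mem {bg : Bigrading K R 𝒜 M} {f : R} {a : ℕ × ℕ} (hf : f ∈ 𝒜 a)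
    {b : ℤ × ℤ} {x : M} (hx : x ∈ bg.grading b) : toAway f M x ∈ bg.awayGrading hf b :=
  ⟨0, x, by simpa using hx, by simp⟩

theorem exists_common_pow (bg : Bigrading K R 𝒜 M) {f : R} {a : ℕ × ℕ} (hf : f ∈ 𝒜 a)
    {b : ℤ × ℤ} {z : ModAway f M} (hz : z ∈ bg.awayGrading hf b) :
    ∃ n₀ : ℕ, ∀ n ≥ n₀, ∃ x ∈ bg.grading (b + n • ((a.1 : ℤ), (a.2 : ℤ))),
      f ^ n • z = toAway f M x := by
  obtain ⟨n₀, x, hx, h⟩ := hz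
  refine ⟨n₀, fun n hn => ?_⟩
  obtain ⟨k, rfl⟩ := Nat.exists_eq_add_of_le hn
  refine ⟨f ^ k • x, ?_, ?_⟩
  · rw [add_smul, ← add_assoc]
    exact bg.pow_smul_mem hf k hx
  · rw [map_smul, ← h, smul_smul, ← pow_add, add_comm]

theorem iSup_awayGrading (bg : Bigrading K R 𝒜 M) {f : R} {a : ℕ × ℕ} (hf : f ∈ 𝒜 a) :
    iSup (bg.awayGrading hf) = ⊤ := by
  rw [eq_top_iff]
  rintro z -
  obtain ⟨n, x, h⟩ := exists_pow_smul_eq_toAway f z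
  induction x using bg.induction_on generalizing z with
  | hom b x hx =>
    refine AddSubgroup.mem_iSup_of_mem (b - n • ((a.1 : ℤ), (a.2 : ℤ))) ⟨n, x, ?_, h⟩
    rwa [sub_add_cancel]
  | zero =>
    rw [eq_zero_of_pow_smul_away f n (h.trans (map_zero _))]
    exact zero_mem _
  | add x y hx hy =>
    obtain ⟨w, hw⟩ := exists_pow_smul_away f n (toAway f M x)
    rw [← add_sub_cancel w z]
    refine add_mem (hx hw) (hy ?_)
    rw [smul_sub, h, hw, map_add, add_sub_cancel_left]

/-- The bigrading of the localization at a homogeneous element. -/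
def away (bg : Bigrading K R 𝒜 M) {f : R} {a : ℕ × ℕ} (hf : f ∈ 𝒜 a) :
    Bigrading K R 𝒜 (ModAway f M) :=
  ofISup (bg.awayGrading hf) (bg.iSup_awayGrading hf)
    (fun s d hd h => by
      choose n₀ hn₀ using fun b => bg.exists_common_pow hf (hd b)
      obtain ⟨n, hn⟩ : ∃ n, ∀ b ∈ s, n₀ b ≤ n := ⟨s.sup n₀, fun b hb => Finset.le_sup hb⟩
      have h₁ : ∀ b, ∃ x ∈ bg.grading (b + n • ((a.1 : ℤ), (a.2 : ℤ))),
          b ∈ s → f ^ n • d b = toAway f M x := by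
        intro b
        by_cases hb : b ∈ s
        · obtain ⟨x, hx, hx'⟩ := hn₀ b n (hn b hb)
          exact ⟨x, hx, fun _ => hx'⟩
        · exact ⟨0, zero_mem _, fun h => (hb h).elim⟩
      choose x hx hx' using h₁
      have h₂ : toAway f M (∑ b ∈ s, x b) = 0 := by
        rw [map_sum, ← Finset.sum_congr rfl hx', ← Finset.smul_sum, h, smul_zero]
      obtain ⟨k, hk⟩ := (toAway_eq_zero_iff f).1 h₂
      intro b hb
      refine eq_zero_of_pow_smul_away f n ((hx' b hb).trans
        ((toAway_eq_zero_iff f).2 ⟨k, ?_⟩))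
      have h₃ := bg.proj_pow_smul hf k (b + n • ((a.1 : ℤ), (a.2 : ℤ))) (∑ b ∈ s, x b)
      rw [hk, map_zero, map_sum, Finset.sum_eq_single_of_mem b hb, bg.proj_of_mem (hx b)] at h₃
      · exact h₃.symm
      · exact fun c _ hc => bg.proj_of_mem_ne (hx c) fun h' => hc (add_right_cancel h'))
    (by
      rintro c b r z hr ⟨n, x, hx, h⟩
      refine ⟨n, r • x, ?_, by rw [smul_comm, h, map_smul]⟩
      rw [add_assoc]
      exact bg.compat c _ r x hr hx)

theorem awayMap_mem {bg : Bigrading K R 𝒜 M} {bg' : Bigrading K R 𝒜 N} {f : R} {a : ℕ × ℕ}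
    (hf : f ∈ 𝒜 a) {φ : M →ₗ[R] N} (hφ : ∀ b, ∀ x ∈ bg.grading b, φ x ∈ bg'.grading b)
    {b : ℤ × ℤ} {z : ModAway f M} (hz : z ∈ bg.awayGrading hf b) :
    awayMap f φ z ∈ bg'.awayGrading hf b := by
  obtain ⟨n, x, hx, h⟩ := hz
  exact ⟨n, φ x, hφ _ x hx, by rw [← map_smul, h, awayMap_toAway]⟩

end Bigrading

namespace ModComplex

variable (K 𝒜) in
/-- A bigrading of a complex. -/
structure Gr (C : ModComplex R) where
  /-- The bigradings of the terms. -/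
  bg : ∀ k, Bigrading K R 𝒜 (C.X k)
  d_mem : ∀ k b, ∀ x ∈ (bg k).grading b, C.d k x ∈ (bg (k + 1)).grading b

namespace Gr

variable [GradedAlgebra 𝒜] {C : ModComplex R} (γ : Gr K 𝒜 C)

/-- The bigrading of the preceding term. -/
def bgPrev : ∀ k, Bigrading K R 𝒜 (C.prev k)
  | 0 => Bigrading.ofSubsingleton PUnit
  | k + 1 => γ.bg k

theorem dPrev_mem : ∀ k b, ∀ x ∈ (γ.bgPrev k).grading b, C.dPrev k x ∈ (γ.bg k).grading b
  | 0, _, _, _ => zero_mem _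
  | k + 1, b, x, hx => γ.d_mem k b x hx

omit [GradedAlgebra 𝒜] in
theorem proj_mem_cocycles {k : ℕ} {x : C.X k} (hx : x ∈ C.cocycles k) (b : ℤ × ℤ) :
    (γ.bg k).proj b x ∈ C.cocycles k := by
  have h := (γ.bg k).proj_map_zero (γ.bg (k + 1)) (C.d k).toAddMonoidHom (γ.d_mem k) b x
  rw [LinearMap.mem_ker]
  refine h.symm.trans ?_
  rw [LinearMap.toAddMonoidHom_coe, LinearMap.mem_ker.1 hx, map_zero]

/-- The homogeneous components of the cohomology of a bigraded complex. -/
def hGrading (k : ℕ) (b : ℤ × ℤ) : AddSubgroup (C.H k) :=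
  (((γ.bg k).grading b).comap (C.cocycles k).subtype.toAddMonoidHom).map (C.cls k).toAddMonoidHom

omit [GradedAlgebra 𝒜] in
theorem mem_hGrading {k : ℕ} {b : ℤ × ℤ} {z : C.H k} : z ∈ γ.hGrading k b ↔
    ∃ x : C.cocycles k, x.1 ∈ (γ.bg k).grading b ∧ C.cls k x = z := Iff.rfl

omit [GradedAlgebra 𝒜] in
theorem iSup_hGrading (k : ℕ) : iSup (γ.hGrading k) = ⊤ := by
  rw [eq_top_iff]
  intro z _
  obtain ⟨x, rfl⟩ := C.cls_surjective k z
  obtain ⟨s, hs, -⟩ := (γ.bg k).exists_sum_proj x.1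
  have : x = ∑ b ∈ s, (⟨(γ.bg k).proj b x, γ.proj_mem_cocycles x.2 b⟩ : C.cocycles k) :=
    Subtype.ext (by rw [AddSubmonoidClass.coe_finsetSum]; exact hs)
  rw [this, map_sum]
  exact sum_mem fun b _ =>
    AddSubgroup.mem_iSup_of_mem b ⟨_, (γ.bg k).proj_mem b x.1, rfl⟩

/-- The bigrading of the cohomology of a bigraded complex. -/
def homology (k : ℕ) : Bigrading K R 𝒜 (C.H k) :=
  Bigrading.ofISup (γ.hGrading k) (γ.iSup_hGrading k)
    (fun s d hd h b hb => by
      choose x hx hx' using fun b => γ.mem_hGrading.1 (hd b)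
      have h₁ : C.cls k (∑ b ∈ s, x b) = 0 := by
        rw [map_sum, Finset.sum_congr rfl fun b _ => hx' b, h]
      obtain ⟨w, hw⟩ := C.cls_eq_zero.1 h₁
      rw [← hx' b, C.cls_eq_zero]
      refine ⟨(γ.bgPrev k).proj b w, ?_⟩
      have h₂ := (γ.bgPrev k).proj_map_zero (γ.bg k) (C.dPrev k).toAddMonoidHom
        (γ.dPrev_mem k) b w
      refine h₂.symm.trans ?_
      rw [LinearMap.toAddMonoidHom_coe, hw, AddSubmonoidClass.coe_finsetSum]
      exact (γ.bg k).proj_sum (d := fun b => (x b).1) hx hb)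
    (by
      rintro a b r _ hr ⟨x, hx, rfl⟩
      exact ⟨r • x, (γ.bg k).compat a b r x.1 hr hx, map_smul (C.cls k) r x⟩)

theorem homology_eq_bot {k : ℕ} {b : ℤ × ℤ} (h : (γ.bg k).grading b = ⊥) :
    (γ.homology k).grading b = ⊥ := by
  rw [AddSubgroup.eq_bot_iff_forall] at h ⊢
  rintro _ ⟨x, hx, rfl⟩
  have : x = 0 := Subtype.ext (h _ hx)
  rw [this]
  exact map_zero _

/-- The bigrading of a complex concentrated in degree zero. -/
def single {M : Type u} [AddCommGroup M] [Module R M] (bg : Bigrading K R 𝒜 M) :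
    Gr K 𝒜 (ModComplex.single (A := R) M) where
  bg k := match k with
    | 0 => bg
    | _ + 1 => Bigrading.ofSubsingleton PUnit
  d_mem _ _ _ _ := zero_mem _

/-- The bigrading of the fiber of a localization map. -/
def fib {f : R} {a : ℕ × ℕ} (hf : f ∈ 𝒜 a) : Gr K 𝒜 (C.Fib f) where
  bg k := (γ.bg k).prod ((γ.bgPrev k).away hf)
  d_mem k b x hx := ⟨γ.d_mem k b x.1 hx.1, AddSubgroup.sub_mem _ (Bigrading.toAway_mem hf hx.1)
    (Bigrading.awayMap_mem hf (γ.dPrev_mem k) hx.2)⟩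

theorem fib_eq_bot {f : R} (hf : f ∈ 𝒜 (0, 1)) {i : ℤ}
    (h : ∀ k j, (γ.bg k).grading (i, j) = ⊥) (k : ℕ) (j : ℤ) :
    ((γ.fib hf).bg k).grading (i, j) = ⊥ := by
  have h' : ∀ j, (γ.bgPrev k).grading (i, j) = ⊥ := fun j =>
    match k with
    | 0 => rfl
    | k + 1 => h k j
  rw [AddSubgroup.eq_bot_iff_forall]
  rintro ⟨x, z⟩ ⟨hx, n, y, hy, hz⟩
  refine Prod.ext ((AddSubgroup.eq_bot_iff_forall _).1 (h k j) x hx) ?_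
  have : (i, j) + n • (((0 : ℕ) : ℤ), ((1 : ℕ) : ℤ)) = (i, j + n) := by simp
  rw [this] at hy
  rw [(AddSubgroup.eq_bot_iff_forall _).1 (h' _) y hy, map_zero] at hz
  exact eq_zero_of_pow_smul_away f n hz

end Gr

end ModComplex

variable [GradedAlgebra 𝒜]

theorem exists_gr_cech (bg : Bigrading K R 𝒜 M) : ∀ L : List R, (∀ f ∈ L, ∃ a, f ∈ 𝒜 a) →
    ∃ _ : (Cech M L).Gr K 𝒜, True
  | [], _ => ⟨ModComplex.Gr.single bg, trivial⟩
  | f :: L, h => by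
    obtain ⟨γ, -⟩ := exists_gr_cech bg L fun g hg => h g (List.mem_cons_of_mem _ hg)
    obtain ⟨a, ha⟩ := h f List.mem_cons_self
    exact ⟨γ.fib ha, trivial⟩

theorem exists_gr_cech_eq_bot (bg : Bigrading K R 𝒜 M) {i₀ : ℤ}
    (hbg : ∀ i < i₀, ∀ j, bg.grading (i, j) = ⊥) : ∀ L : List R, (∀ f ∈ L, f ∈ 𝒜 (0, 1)) →
    ∃ γ : (Cech M L).Gr K 𝒜, ∀ i < i₀, ∀ k j, (γ.bg k).grading (i, j) = ⊥
  | [], _ => ⟨ModComplex.Gr.single bg, fun i hi k j =>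
      match k with
      | 0 => hbg i hi j
      | _ + 1 => rfl⟩
  | f :: L, h => by
    obtain ⟨γ, hγ⟩ := exists_gr_cech_eq_bot bg hbg L fun g hg => h g (List.mem_cons_of_mem _ hg)
    exact ⟨γ.fib (h f List.mem_cons_self), fun i hi k j =>
      γ.fib_eq_bot (h f List.mem_cons_self) (hγ i hi) k j⟩

end Bigraded

/-! ### Consequences of the bigrading -/

section Tameness

variable {K R 𝒜} {M : Type u} [AddCommGroup M] [Module R M]

namespace Bigrading

variable (bg : Bigrading K R 𝒜 M)

theorem grading_ne_bot {b : ℤ × ℤ} {x : M} (hx : x ∈ bg.grading b) (h : x ≠ 0) :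
    bg.grading b ≠ ⊥ := fun h' => h ((AddSubgroup.eq_bot_iff_forall _).1 h' x hx)

/-- If every element is a combination of given homogeneous elements of degree `a`, then
nonvanishing of components propagates downwards by `a`. -/
theorem grading_ne_bot_of_eq_sum_smul {n : ℕ} {x : Fin n → R} {a : ℕ × ℕ} (hx : ∀ k, x k ∈ 𝒜 a)
    (h : ∀ z : M, ∃ w : Fin n → M, z = ∑ k, x k • w k) {b : ℤ × ℤ}
    (hb : bg.grading (((a.1 : ℤ), (a.2 : ℤ)) + b) ≠ ⊥) : bg.grading b ≠ ⊥ := by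
  intro h₀
  refine hb ((AddSubgroup.eq_bot_iff_forall _).2 fun z hz => ?_)
  obtain ⟨w, hw⟩ := h z
  rw [← bg.proj_of_mem hz, hw, map_sum]
  refine Finset.sum_eq_zero fun k _ => ?_
  rw [bg.proj_smul (hx k), (AddSubgroup.eq_bot_iff_forall _).1 h₀ _ (bg.proj_mem b (w k)),
    smul_zero]

theorem eq_zero_of_grading_eq_bot (h : ∀ b, bg.grading b = ⊥) (x : M) : x = 0 :=
  bg.eq_zero_of_proj_eq_zero fun b => (AddSubgroup.eq_bot_iff_forall _).1 (h b) _ (bg.proj_mem b x)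

theorem smul_proj_eq_zero {f : R} {a : ℕ × ℕ} (hf : f ∈ 𝒜 a) {x : M} (h : f • x = 0)
    (b : ℤ × ℤ) : f • bg.proj b x = 0 := by
  rw [← bg.proj_smul hf, h, map_zero]

theorem isTame_of_sub_one
    (h : ∀ i j, bg.grading (i, j) ≠ ⊥ → ∃ i', bg.grading (i', j - 1) ≠ ⊥) : IsTame K R 𝒜 bg := by
  by_cases h₀ : ∃ i j, bg.grading (i, j) ≠ ⊥
  · obtain ⟨i, j, hij⟩ := h₀
    refine ⟨j, Or.inr fun j' hj' => ?_⟩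
    induction j', hj' using Int.leInductionDown with
    | base => exact ⟨i, hij⟩
    | pred n _ ih =>
      obtain ⟨i', hi'⟩ := ih
      exact h i' n hi'
  · push Not at h₀
    exact ⟨0, Or.inl fun j _ i => h₀ i j⟩

theorem isTame_of_add_one (j₀ : ℤ)
    (h : ∀ i, ∀ j < j₀, bg.grading (i, j) ≠ ⊥ → ∃ i', bg.grading (i', j + 1) ≠ ⊥) :
    IsTame K R 𝒜 bg := by
  by_cases h₀ : ∃ j₁, ∀ j ≤ j₁, ∀ i, bg.grading (i, j) = ⊥
  · obtain ⟨j₁, hj₁⟩ := h₀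
    exact ⟨j₁, Or.inl hj₁⟩
  · push Not at h₀
    refine ⟨j₀, Or.inr fun j hj => ?_⟩
    obtain ⟨j', hj', h'⟩ := h₀ j
    clear h₀
    induction j, hj' using Int.leInduction with
    | base => exact h'
    | succ n _ ih =>
      obtain ⟨i, hi⟩ := ih (by omega)
      exact h i n (by omega) hi

variable [GradedAlgebra 𝒜]

/-- The submodule of elements whose components have both degrees at least `i`. -/
def boundedBelow (i : ℤ) : Submodule R M where
  carrier := {x | ∀ b, bg.proj b x ≠ 0 → i ≤ b.1 ∧ i ≤ b.2}
  zero_mem' b h := (h (map_zero _)).elim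
  add_mem' {x y} hx hy b h := by
    by_cases h' : bg.proj b x = 0
    · refine hy b fun h'' => h ?_
      rw [map_add, h', h'', add_zero]
    · exact hx b h'
  smul_mem' r x hx := by
    induction r using DirectSum.Decomposition.inductionOn 𝒜 with
    | zero =>
      rw [zero_smul]
      exact fun b h => (h (map_zero _)).elim
    | @homogeneous a r =>
      intro b hb
      have h := bg.proj_smul r.2 (b - ((a.1 : ℤ), (a.2 : ℤ))) x
      rw [add_sub_cancel] at h
      have h' := hx (b - ((a.1 : ℤ), (a.2 : ℤ))) fun h' => hb (by rw [h, h', smul_zero])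
      rw [Prod.fst_sub, Prod.snd_sub] at h'
      omega
    | add r r' hr hr' =>
      intro b hb
      by_cases h' : bg.proj b (r • x) = 0
      · refine hr' b fun h'' => hb ?_
        rw [add_smul, map_add, h', h'', add_zero]
      · exact hr b h'

theorem boundedBelow_anti {i i' : ℤ} (h : i ≤ i') : bg.boundedBelow i' ≤ bg.boundedBelow i :=
  fun _ hx b hb => ⟨h.trans (hx b hb).1, h.trans (hx b hb).2⟩

theorem exists_le_boundedBelow {W : Submodule R M} (hW : W.FG) : ∃ i, W ≤ bg.boundedBelow i := by
  induction W, hW using Submodule.fg_induction with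
  | singleton x =>
    obtain ⟨s, -, hs⟩ := bg.exists_sum_proj x
    obtain ⟨i, hi⟩ := (s.image Prod.fst ∪ s.image Prod.snd).bddBelow
    refine ⟨i, (Submodule.span_singleton_le_iff_mem _ _).2 fun b hb => ?_⟩
    have hb' : b ∈ s := by_contra fun h => hb (hs b h)
    exact ⟨hi (by simpa using Or.inl ⟨b.2, hb'⟩), hi (by simpa using Or.inr ⟨b.1, hb'⟩)⟩
  | sup W W' _ _ h h' =>
    obtain ⟨i, hi⟩ := h
    obtain ⟨i', hi'⟩ := h'
    exact ⟨min i i', sup_le (hi.trans (bg.boundedBelow_anti (min_le_left _ _)))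
      (hi'.trans (bg.boundedBelow_anti (min_le_right _ _)))⟩

theorem le_of_mem_boundedBelow {i : ℤ} {b : ℤ × ℤ} {x : M} (hx : x ∈ bg.boundedBelow i)
    (hb : x ∈ bg.grading b) (h : x ≠ 0) : i ≤ b.1 ∧ i ≤ b.2 :=
  hx b (by rwa [bg.proj_of_mem hb])

end Bigrading

theorem acyclic_of_annihilator_le_of_lt {A M : Type u} [CommRing A] [IsNoetherianRing A]
    [AddCommGroup M] [Module A M] [Module.Finite A M] {L : List A} {s : ℕ}
    (h : ∀ i, s < i → (Cech M L).Acyclic i)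
    (N : Type u) [AddCommGroup N] [Module A N] [Module.Finite A N]
    (hN : Module.annihilator A M ≤ Module.annihilator A N) {i : ℕ} (hi : s < i) :
    (Cech N L).Acyclic i := by
  obtain ⟨d, hd⟩ : ∃ d, L.length < i + d := ⟨L.length + 1, by omega⟩
  induction d generalizing i N with
  | zero => exact cech_acyclic_of_length_lt hd
  | succ d ih =>
    exact cech_acyclic_of_annihilator_le M (h i hi)
      (fun N' _ _ _ hN' => ih N' hN' (by omega) (by omega)) N hN

section Noetherian

variable [GradedAlgebra 𝒜] [IsNoetherianRing R] [Module.Finite R M] (bg : Bigrading K R 𝒜 M)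

include bg

theorem cech_acyclic_of_append {m : ℕ} {x : Fin m → R} (hx : ∀ k, x k ∈ 𝒜 (1, 0)) {L : List R}
    (hL : ∀ f ∈ L, f ∈ 𝒜 (0, 1)) {s : ℕ}
    (h : ∀ i, s < i → (Cech M (List.ofFn x ++ L)).Acyclic i) {i : ℕ} (hi : s < i) :
    (Cech M L).Acyclic i := by
  obtain ⟨d, hd⟩ : ∃ d, L.length < i + d := ⟨L.length + 1, by omega⟩
  induction d generalizing i with
  | zero => exact cech_acyclic_of_length_lt hd
  | succ d ih =>
    have h₁ : ∀ z : (Cech M L).H i, ∃ w : Fin m → (Cech M L).H i, z = ∑ k, x k • w k := by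
      refine cech_exists_eq_sum_smul (fun N _ _ _ hN => ?_) x (fun N _ _ _ hN hN' => ?_)
      · exact acyclic_of_annihilator_le_of_lt (s := i)
          (fun i' hi' => ih (by omega) (by omega)) N hN (Nat.lt_succ_self i)
      · rw [← cech_append_acyclic_iff L i (List.ofFn x)]
        · exact acyclic_of_annihilator_le_of_lt h N hN hi
        · intro f hf z
          obtain ⟨k, rfl⟩ := (List.mem_ofFn' _ _).1 hf
          exact ⟨1, by rw [pow_one, hN']⟩
    obtain ⟨i₀, hi₀⟩ := bg.exists_le_boundedBelow (Module.Finite.fg_top (R := R) (M := M))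
    obtain ⟨γ, hγ⟩ := exists_gr_cech_eq_bot bg (i₀ := i₀) (fun i' hi' j =>
      (AddSubgroup.eq_bot_iff_forall _).2 fun z hz => by
        by_contra h
        exact absurd (bg.le_of_mem_boundedBelow (hi₀ (Submodule.mem_top (x := z))) hz h).1
          (not_le.2 hi')) L hL
    rw [ModComplex.acyclic_iff]
    refine (γ.homology i).eq_zero_of_grading_eq_bot fun b => ?_
    obtain ⟨n, hn⟩ : ∃ n : ℕ, b.1 < i₀ + n := ⟨(b.1 - i₀ + 1).toNat, by omega⟩
    induction n generalizing b with
    | zero => exact γ.homology_eq_bot (hγ _ (by simpa using hn) i b.2)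
    | succ n ih' =>
      by_contra hb
      refine (γ.homology i).grading_ne_bot_of_eq_sum_smul hx h₁ (b := b - (1, 0)) ?_
        (ih' _ ?_)
      · simpa using hb
      · rw [Prod.fst_sub]
        omega

theorem cech_acyclic_of_cons {x : R} (hx : x ∈ 𝒜 (1, 0)) {L : List R}
    (hL : ∀ f ∈ L, ∃ a, f ∈ 𝒜 a) {n : ℕ}
    (h : ∀ i < n + 1, (Cech M (x :: L)).Acyclic i) {i : ℕ} (hi : i < n) :
    (Cech M L).Acyclic i := by
  induction i using Nat.strong_induction_on with
  | _ i ih =>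
    obtain ⟨W, hW, hW'⟩ := exists_fg_socle L i M fun j hj => ih j hj (by omega)
    obtain ⟨γ, -⟩ := exists_gr_cech bg L hL
    set bh := γ.homology i
    obtain ⟨i₀, hi₀⟩ := bh.exists_le_boundedBelow hW
    have inj : ∀ z : (Cech M L).H i, x • z = 0 → z = 0 := by
      intro z hz
      obtain ⟨y, rfl⟩ := ModComplex.cls_surjective _ i z
      rw [← map_smul, ModComplex.cls_eq_zero] at hz
      exact (ModComplex.cls_eq_zero _).2
        (ModComplex.mem_coboundaries_of_smul_mem (h i (by omega)) y.2 hz)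
    have surj : ∀ z : (Cech M L).H i, ∃ w, z = x • w := by
      intro z
      obtain ⟨y, rfl⟩ := ModComplex.cls_surjective _ i z
      obtain ⟨w, hw, hyw⟩ := ModComplex.exists_sub_smul_mem_coboundaries (h i (by omega))
        (h (i + 1) (by omega)) y.2
      refine ⟨(Cech M L).cls i ⟨w, hw⟩, sub_eq_zero.1 ?_⟩
      rw [← map_smul, ← map_sub]
      exact (ModComplex.cls_eq_zero _).2 hyw
    refine cech_acyclic_of_socle fun z hz => bh.eq_zero_of_proj_eq_zero fun b => ?_
    have key : ∀ (d : ℕ) (b : ℤ × ℤ), b.1 < i₀ + d → ∀ y : (Cech M L).H i,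
        (∀ f ∈ L, f • y = 0) → bh.proj b y = 0 := by
      intro d
      induction d with
      | zero =>
        intro b hb y hy
        by_contra h₀
        have h₁ : bh.proj b y ∈ bh.boundedBelow i₀ := hi₀ (hW' _ fun f hf => by
          obtain ⟨a, ha⟩ := hL f hf
          exact bh.smul_proj_eq_zero ha (hy f hf) b)
        have h₂ := (bh.le_of_mem_boundedBelow h₁ (bh.proj_mem b y) h₀).1
        simp at hb
        omega
      | succ d ihd =>
        intro b hb y hy
        obtain ⟨w, rfl⟩ := surj y
        have h₁ := bh.proj_smul hx (b - (1, 0)) w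
        rw [show (((((1, 0) : ℕ × ℕ).1 : ℤ), (((1, 0) : ℕ × ℕ).2 : ℤ)) + (b - (1, 0))) = b by
          simp] at h₁
        rw [h₁, ihd (b - (1, 0)) (by rw [Prod.fst_sub]; push_cast at hb; omega) w fun f hf =>
          inj _ (by rw [smul_comm, hy f hf]), smul_zero]
    exact key (b.1 - i₀ + 1).toNat b (by omega) z hz

theorem cech_acyclic_of_append_of_lt {m : ℕ} {X : List R} (hX : ∀ x ∈ X, x ∈ 𝒜 (1, 0))
    (hm : X.length = m) {L : List R} (hL : ∀ f ∈ L, ∃ a, f ∈ 𝒜 a) {n : ℕ}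
    (h : ∀ i < n + m, (Cech M (X ++ L)).Acyclic i) {i : ℕ} (hi : i < n) :
    (Cech M L).Acyclic i := by
  induction X generalizing m n i with
  | nil =>
    subst hm
    exact h i hi
  | cons x X ih =>
    subst hm
    refine ih (fun y hy => hX y (List.mem_cons_of_mem _ hy)) rfl (fun j hj => ?_) hi
    refine cech_acyclic_of_cons bg (hX x List.mem_cons_self) (fun f hf => ?_)
      (n := n + X.length) (fun j hj => h j (by simpa [add_assoc] using hj)) hj
    rcases List.mem_append.1 hf with hf | hf
    · exact ⟨_, hX f (List.mem_cons_of_mem _ hf)⟩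
    · exact hL f hf

/-- Tameness of the last cohomology module. -/
theorem exists_isTame_top {n : ℕ} {y : Fin n → R} (hy : ∀ k, y k ∈ 𝒜 (0, 1)) {s : ℕ}
    (h : ∀ i, s < i → (Cech M (List.ofFn y)).Acyclic i) :
    ∃ bh : Bigrading K R 𝒜 ((Cech M (List.ofFn y)).H s), IsTame K R 𝒜 bh := by
  have hL : ∀ f ∈ List.ofFn y, f ∈ 𝒜 (0, 1) := by
    intro f hf
    obtain ⟨k, rfl⟩ := (List.mem_ofFn' _ _).1 hf
    exact hy k
  obtain ⟨γ, -⟩ := exists_gr_cech bg (List.ofFn y) fun f hf => ⟨_, hL f hf⟩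
  refine ⟨γ.homology s, ?_⟩
  rcases Nat.eq_zero_or_pos s with rfl | hs
  · have : IsNoetherian R ((Cech M (List.ofFn y)).X 0) :=
      isNoetherian_of_linearEquiv (cechAug (M := M) (List.ofFn y))
    have : IsNoetherian R ((Cech M (List.ofFn y)).H 0) :=
      isNoetherian_of_surjective ((Cech M (List.ofFn y)).cls 0)
        (LinearMap.range_eq_top.2 (ModComplex.cls_surjective _ 0))
    obtain ⟨j₀, hj₀⟩ := (γ.homology 0).exists_le_boundedBelow (IsNoetherian.noetherian ⊤)
    refine ⟨j₀ - 1, Or.inl fun j hj i => (AddSubgroup.eq_bot_iff_forall _).2 fun z hz => ?_⟩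
    by_contra h₀
    have := ((γ.homology 0).le_of_mem_boundedBelow (hj₀ Submodule.mem_top) hz h₀).2
    simp at this
    omega
  · refine (γ.homology s).isTame_of_sub_one fun i j hij => ⟨i, ?_⟩
    refine (γ.homology s).grading_ne_bot_of_eq_sum_smul hy (fun z => ?_) (b := (i, j - 1)) ?_
    · refine cech_exists_eq_sum_smul (fun N _ _ _ hN =>
        acyclic_of_annihilator_le_of_lt h N hN (Nat.lt_succ_self s)) y (fun N _ _ _ _ hN' => ?_) z
      refine cech_acyclic_of_torsion _ (fun f hf z => ?_) hs
      obtain ⟨k, rfl⟩ := (List.mem_ofFn' _ _).1 hf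
      exact ⟨1, by rw [pow_one, hN']⟩
    · simpa using hij

/-- Tameness of the first possibly nonzero cohomology module. -/
theorem exists_isTame_bot {L : List R} (hL : ∀ f ∈ L, f ∈ 𝒜 (0, 1)) {g : ℕ}
    (h : ∀ i < g, (Cech M L).Acyclic i) :
    ∃ bh : Bigrading K R 𝒜 ((Cech M L).H g), IsTame K R 𝒜 bh := by
  obtain ⟨W, hW, hW'⟩ := exists_fg_socle L g M h
  obtain ⟨γ, -⟩ := exists_gr_cech bg L fun f hf => ⟨_, hL f hf⟩
  obtain ⟨j₀, hj₀⟩ := (γ.homology g).exists_le_boundedBelow hW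
  refine ⟨γ.homology g, (γ.homology g).isTame_of_add_one j₀ fun i j hj hij => ⟨i, ?_⟩⟩
  obtain ⟨⟨z, hz⟩, h₀⟩ := AddSubgroup.ne_bot_iff_exists_ne_zero.1 hij
  replace h₀ : z ≠ 0 := fun h' => h₀ (Subtype.ext h')
  have h₁ : ∃ f ∈ L, f • z ≠ 0 := by
    by_contra! h₁
    have := ((γ.homology g).le_of_mem_boundedBelow (hj₀ (hW' _ h₁)) hz h₀).2
    simp at this
    omega
  obtain ⟨f, hf, hfz⟩ := h₁
  have h₂ := (γ.homology g).compat _ _ f _ (hL f hf) hz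
  rw [show (((((0, 1) : ℕ × ℕ).1 : ℤ), (((0, 1) : ℕ × ℕ).2 : ℤ)) + (i, j)) = (i, j + 1) by
    simp [add_comm]] at h₂
  exact (γ.homology g).grading_ne_bot h₂ hfz

end Noetherian

end Tameness

/-! ### Standard bigraded algebras -/

section Standard

variable {K R 𝒜} {M : Type u} [AddCommGroup M] [Module R M]

theorem IsStandardBigraded.isNoetherianRing [GradedAlgebra 𝒜] (h : IsStandardBigraded K R 𝒜) :
    IsNoetherianRing R := by
  obtain ⟨S, hS⟩ := h.fg10
  obtain ⟨T, hT⟩ := h.fg01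
  have h' := h.adjoin_eq_top
  rw [← hS, ← hT, ← Algebra.adjoin_span, Submodule.span_union, Submodule.span_span,
    Submodule.span_span, ← Submodule.span_union, Algebra.adjoin_span] at h'
  have : Algebra.FiniteType K R := ⟨by
    classical exact ⟨S ∪ T, by rw [Finset.coe_union]; exact h'⟩⟩
  exact Algebra.FiniteType.isNoetherianRing K R

theorem span_mem_ofFn {A : Type u} [CommRing A] {n : ℕ} (x : Fin n → A) :
    Ideal.span {f | f ∈ List.ofFn x} = Ideal.span (Set.range x) := by
  congr 1
  ext f
  exact List.mem_ofFn' _ _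

theorem span_mem_append {A : Type u} [CommRing A] (L L' : List A) :
    Ideal.span {f | f ∈ L ++ L'} = Ideal.span {f | f ∈ L} ⊔ Ideal.span {f | f ∈ L'} := by
  rw [← Ideal.span_union]
  congr 1
  ext f
  exact List.mem_append

theorem IsStandardBigraded.exists_generators_idealQ [GradedAlgebra 𝒜]
    (h : IsStandardBigraded K R 𝒜) : ∃ (n : ℕ) (y : Fin n → R), (∀ k, y k ∈ 𝒜 (0, 1)) ∧
      idealQ K R 𝒜 = Ideal.span {f | f ∈ List.ofFn y} := by
  obtain ⟨n, y, hy⟩ := Submodule.fg_iff_exists_fin_generating_family.1 h.fg01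
  refine ⟨n, y, fun k => ?_, ?_⟩
  · rw [← hy]
    exact Submodule.subset_span ⟨k, rfl⟩
  · rw [span_mem_ofFn, idealQ, ← hy]
    exact Submodule.span_span_of_tower K R (Set.range y)

theorem MinimallyGeneratedBy.exists_generators {m : ℕ} (h : MinimallyGeneratedBy K R 𝒜 m) :
    ∃ x : Fin m → R, (∀ k, x k ∈ 𝒜 (1, 0)) ∧
      idealP K R 𝒜 = Ideal.span {f | f ∈ List.ofFn x} := by
  obtain ⟨⟨s, hs, hs', rfl⟩, -⟩ := h
  refine ⟨fun k => s.equivFin.symm k, fun k => hs (s.equivFin.symm k).2, ?_⟩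
  rw [span_mem_ofFn, ← hs']
  congr 1
  ext f
  exact ⟨fun hf => ⟨s.equivFin ⟨f, hf⟩, by simp⟩, fun ⟨k, hk⟩ => hk ▸ (s.equivFin.symm k).2⟩

theorem nonempty_LC_equiv [IsNoetherianRing R] {I : Ideal R} {L : List R}
    (hI : I = Ideal.span {f | f ∈ L}) (k : ℕ) (M : Type u) [AddCommGroup M] [Module R M] :
    Nonempty (LC R I (k : ℤ) M ≃ₗ[R] (Cech M L).H k) := by
  subst hI
  rw [LC, if_pos (Int.natCast_nonneg k), Int.toNat_natCast]
  exact nonempty_localCohomology_equiv L k M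

theorem cech_acyclic_of_subsingleton_LC [IsNoetherianRing R] {I : Ideal R} {L : List R}
    (hI : I = Ideal.span {f | f ∈ L}) {k : ℕ} (h : Subsingleton (LC R I (k : ℤ) M)) :
    (Cech M L).Acyclic k := by
  obtain ⟨e⟩ := nonempty_LC_equiv hI k M
  rw [ModComplex.acyclic_iff]
  intro z
  rw [← e.apply_symm_apply z, Subsingleton.elim (e.symm z) 0, map_zero]

end Standard

/-- **Corollary 2.4.**  Let `R` be a standard bigraded `K`-algebra with irrelevant bigraded
ideals `P` and `Q`, `P` minimally generated by `m` homogeneous elements, and let `M` be a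
finitely generated bigraded `R`-module of dimension `s` and depth `t` (encoded via local
cohomology with respect to `R₊`).  Then the bigraded `R`-modules `H^{t-m}_Q (M)` and
`H^s_Q (M)` are tame. -/
theorem tameness_at_the_corners
    (K R : Type u) [Field K] [CommRing R] [Algebra K R]
    (𝒜 : ℕ × ℕ → Submodule K R) [GradedAlgebra 𝒜]
    (hstd : IsStandardBigraded K R 𝒜)
    (M : Type u) [AddCommGroup M] [Module R M] [Module.Finite R M]
    (bgM : Bigrading K R 𝒜 M)
    (m : ℕ) (hm : MinimallyGeneratedBy K R 𝒜 m)
    (s t : ℕ)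
    (hs : Nontrivial (LC R (idealRPlus K R 𝒜) (s : ℤ) M))
    (hs' : ∀ i : ℤ, (s : ℤ) < i → Subsingleton (LC R (idealRPlus K R 𝒜) i M))
    (ht : Nontrivial (LC R (idealRPlus K R 𝒜) (t : ℤ) M))
    (ht' : ∀ i : ℤ, i < (t : ℤ) → Subsingleton (LC R (idealRPlus K R 𝒜) i M)) :
    (∃ bg : Bigrading K R 𝒜 ↥(LC R (idealQ K R 𝒜) ((t : ℤ) - (m : ℤ)) M), IsTame K R 𝒜 bg) ∧
    (∃ bg : Bigrading K R 𝒜 ↥(LC R (idealQ K R 𝒜) (s : ℤ) M), IsTame K R 𝒜 bg) := by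
  have := hstd.isNoetherianRing
  obtain ⟨n, y, hy, hQ⟩ := hstd.exists_generators_idealQ
  obtain ⟨x, hx, hP⟩ := hm.exists_generators
  have hyL : ∀ f ∈ List.ofFn y, f ∈ 𝒜 (0, 1) := by
    intro f hf
    obtain ⟨k, rfl⟩ := (List.mem_ofFn' _ _).1 hf
    exact hy k
  have hxL : ∀ f ∈ List.ofFn x, f ∈ 𝒜 (1, 0) := by
    intro f hf
    obtain ⟨k, rfl⟩ := (List.mem_ofFn' _ _).1 hf
    exact hx k
  have hPQ : idealRPlus K R 𝒜 = Ideal.span {f | f ∈ List.ofFn x ++ List.ofFn y} := by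
    rw [span_mem_append, ← hP, ← hQ, idealRPlus]
  constructor
  · rcases lt_or_ge t m with htm | hmt
    · rw [LC, if_neg (by omega)]
      exact ⟨Bigrading.ofSubsingleton PUnit, 0, Or.inl fun _ _ _ => rfl⟩
    · obtain ⟨g, rfl⟩ := Nat.exists_eq_add_of_le' hmt
      rw [Nat.cast_add, add_sub_cancel_right]
      obtain ⟨bg, hbg⟩ := exists_isTame_bot bgM hyL (g := g) fun i hi =>
        cech_acyclic_of_append_of_lt bgM hxL List.length_ofFn (fun f hf => ⟨_, hyL f hf⟩)
          (fun i hi => cech_acyclic_of_subsingleton_LC hPQ (ht' i (by exact_mod_cast hi))) hi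
      obtain ⟨e⟩ := nonempty_LC_equiv hQ g M
      exact ⟨bg.transport e.symm, hbg.transport e.symm⟩
  · obtain ⟨bg, hbg⟩ := exists_isTame_top bgM hy (s := s) fun i hi =>
      cech_acyclic_of_append bgM hx hyL
        (fun i hi => cech_acyclic_of_subsingleton_LC hPQ (hs' i (by exact_mod_cast hi))) hi
    obtain ⟨e⟩ := nonempty_LC_equiv hQ s M
    exact ⟨bg.transport e.symm, hbg.transport e.symm⟩
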